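/- arXiv:math/0601524 — 2 statements merged into one kernel-verified Lean document; each statement's English description precedes it below -/
import Mathlib

section
/- Let α : [0,1] → P(S) be continuous, ε > 0, and β a polygonal path with vertices at finitely supported measures with sup_t q(α(t), β(t)) < ε. Then for any continuous lifting α̂ of α (i.e., continuous α̂ : [0,1] → L⁰(Ω,S) with law∘α̂ = α), there exists a continuous lifting β̂ of β with sup_t ρ(α̂(t), β̂(t)) ≤ 5ε. -/
open MeasureTheory Filter Topology Set
open scoped ENNReal NNReal

/-- The Ky Fan distance between two `S`-valued random variables on `(Ω, P)`:
`inf {ε > 0 : P{ω : d(X ω, Y ω) ≥ ε} ≤ ε}`. -/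
noncomputable def kyFanDist {Ω S : Type*} [MeasurableSpace Ω] [PseudoMetricSpace S]
    (P : Measure Ω) (X Y : Ω → S) : ℝ :=
  sInf {ε : ℝ | 0 < ε ∧ (P {ω | ε ≤ dist (X ω) (Y ω)}).toReal ≤ ε}

/-- A measure is nonatomic if every set of positive measure contains a measurable
subset of strictly smaller positive measure. -/
def Nonatomic {Ω : Type*} [MeasurableSpace Ω] (P : Measure Ω) : Prop :=
  ∀ A : Set Ω, MeasurableSet A → 0 < P A →
    ∃ B ⊆ A, MeasurableSet B ∧ 0 < P B ∧ P B < P A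

/-- A finitely supported measure: a finite convex combination of Dirac measures. -/
def FinitelySupported {S : Type*} [MeasurableSpace S] (μ : Measure S) : Prop :=
  ∃ (n : ℕ) (c : Fin n → ℝ≥0∞) (a : Fin n → S),
    (∑ i, c i) = 1 ∧ μ = ∑ i, c i • Measure.dirac (a i)

/-- Continuity of a path of random variables with respect to the Ky Fan metric
(equivalently, the topology of convergence in probability). -/
def KyFanContinuousOn {Ω S : Type*} [MeasurableSpace Ω] [PseudoMetricSpace S]
    (P : Measure Ω) (γ : ℝ → Ω → S) (A : Set ℝ) : Prop :=
  ∀ t ∈ A, ∀ ε > 0, ∃ δ > 0, ∀ s ∈ A, |s - t| < δ → kyFanDist P (γ s) (γ t) < ε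

/-- Continuity of a path of measures with respect to the Lévy–Prokhorov metric. -/
def LPContinuousOn {S : Type*} [MeasurableSpace S] [PseudoMetricSpace S]
    (α : ℝ → Measure S) (A : Set ℝ) : Prop :=
  ∀ t ∈ A, ∀ ε > 0, ∃ δ > 0, ∀ s ∈ A, |s - t| < δ → levyProkhorovDist (α s) (α t) < ε

/-- A polygonal path in the space of measures with vertices in `V`: there is a partition
`0 = t₀ < t₁ < ⋯ < t_{n+1} = 1` and vertices `μᵢ ∈ V` such that on `[tᵢ, tᵢ₊₁]` the path
is the affine interpolation of `μᵢ` and `μᵢ₊₁`. -/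
def IsPolygonalWithVertices {S : Type*} [MeasurableSpace S] (β : ℝ → Measure S)
    (V : Set (Measure S)) : Prop :=
  ∃ (n : ℕ) (t : Fin (n + 2) → ℝ) (μ : Fin (n + 2) → Measure S),
    StrictMono t ∧ t 0 = 0 ∧ t (Fin.last (n + 1)) = 1 ∧ (∀ i, μ i ∈ V) ∧
    ∀ (i : Fin (n + 1)), ∀ s ∈ Set.Icc (t i.castSucc) (t i.succ),
      β s = ENNReal.ofReal ((t i.succ - s) / (t i.succ - t i.castSucc)) • μ i.castSucc
        + ENNReal.ofReal ((s - t i.castSucc) / (t i.succ - t i.castSucc)) • μ i.succ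

/-- Upper envelope of a family of measurable sets strictly ordered by inclusion and measure. -/
lemma chain_sup {Ω : Type*} [MeasurableSpace Ω] (μ : Measure Ω) [IsFiniteMeasure μ]
    (F : Set (Set Ω)) (hm : ∀ B ∈ F, MeasurableSet B)
    (hc : ∀ B ∈ F, ∀ B' ∈ F, B ≠ B' → (B ⊆ B' ∧ μ B < μ B') ∨ (B' ⊆ B ∧ μ B' < μ B)) :
    ∃ L : Set Ω, MeasurableSet L ∧ (∀ B ∈ F, B ⊆ L) ∧
      (∀ T : Set Ω, (∀ B ∈ F, B ⊆ T) → L ⊆ T) ∧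
      (∀ c : ℝ≥0∞, (∀ B ∈ F, μ B ≤ c) → μ L ≤ c) := by
  by_cases hne : F.Nonempty
  swap
  · rw [Set.not_nonempty_iff_eq_empty] at hne
    subst hne
    exact ⟨∅, by simp⟩
  have hsub : ∀ B ∈ F, ∀ B' ∈ F, μ B ≤ μ B' → B ⊆ B' := by
    intro B hB B' hB' h
    by_cases he : B = B'
    · exact he.subset
    · rcases hc B hB B' hB' he with h1 | h1
      · exact h1.1
      · exact absurd h1.2 (not_lt.mpr h)
  by_cases hmax : ∃ M ∈ F, ∀ B ∈ F, μ B ≤ μ M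
  · obtain ⟨M, hM, hMx⟩ := hmax
    exact ⟨M, hm M hM, fun B hB => hsub B hB M hM (hMx B hB), fun T hT => hT M hM,
      fun c h => h M hM⟩
  · push Not at hmax
    obtain ⟨u, hu, htend, humem⟩ := exists_seq_tendsto_sSup (S := μ '' F) (hne.image _)
      (OrderTop.bddAbove _)
    choose B hBF hBu using humem
    have hmono : Monotone B := by
      intro i j hij
      apply hsub _ (hBF i) _ (hBF j)
      rw [hBu, hBu]; exact hu hij
    refine ⟨⋃ n, B n, MeasurableSet.iUnion fun n => hm _ (hBF n), ?_, ?_, ?_⟩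
    · intro C hC
      obtain ⟨M, hM, hlt⟩ := hmax C hC
      have h1 : μ C < sSup (μ '' F) := hlt.trans_le (le_sSup ⟨M, hM, rfl⟩)
      obtain ⟨n, hn⟩ := (htend.eventually (lt_mem_nhds h1)).exists
      refine (hsub C hC _ (hBF n) ?_).trans (subset_iUnion B n)
      rw [hBu]; exact hn.le
    · intro T hT
      exact iUnion_subset fun n => hT _ (hBF n)
    · intro c h
      rw [hmono.measure_iUnion]
      exact iSup_le fun n => h _ (hBF n)

/-- Sierpinski: a nonatomic finite measure admits an increasing family of measurable sets
taking every value. -/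
lemma sierpinski {Ω : Type*} [MeasurableSpace Ω] (μ : Measure Ω) [IsFiniteMeasure μ]
    (hna : Nonatomic μ) :
    ∃ F : ℝ≥0∞ → Set Ω, (∀ c ≤ μ univ, MeasurableSet (F c) ∧ μ (F c) = c) ∧
      ∀ c d, c ≤ d → d ≤ μ univ → F c ⊆ F d := by
  let r : {B : Set Ω // MeasurableSet B} → {B : Set Ω // MeasurableSet B} → Prop :=
    fun B B' => B.1 ⊆ B'.1 ∧ μ B.1 < μ B'.1
  have hspec : IsMaxChain r (maxChain r) := maxChain_spec
  set C := maxChain r with hC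
  have hcomp : ∀ B ∈ C, ∀ B' ∈ C, μ B.1 < μ B'.1 → B.1 ⊆ B'.1 := by
    intro B hB B' hB' h
    have hne : B ≠ B' := by rintro rfl; exact lt_irrefl _ h
    rcases hspec.1 hB hB' hne with h1 | h1
    · exact h1.1
    · exact absurd h1.2 (not_lt.mpr h.le)
  have hins : ∀ D, (∀ B ∈ C, r B D ∨ r D B) → D ∈ C := by
    intro D hD
    have : IsChain r (insert D C) := hspec.1.insert (fun B hB _ => (hD B hB).symm)
    rw [hspec.2 this (subset_insert _ _)]
    exact mem_insert _ _
  have hval : ∀ c ≤ μ univ, ∃ B ∈ C, μ B.1 = c := by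
    intro c hc
    by_contra hno
    push Not at hno
    obtain ⟨L, hLm, hLub, hLl, hLc⟩ := chain_sup μ (Subtype.val '' {B | B ∈ C ∧ μ B.1 < c})
      (by rintro _ ⟨B, -, rfl⟩; exact B.2) (by
        rintro _ ⟨B, hB, rfl⟩ _ ⟨B', hB', rfl⟩ hne
        exact hspec.1 hB.1 hB'.1 (fun h => hne (by rw [h])))
    obtain ⟨U, hUm, hUub, hUl, hUc⟩ :=
      chain_sup μ ((fun B => (Subtype.val B)ᶜ) '' {B | B ∈ C ∧ c < μ B.1})
      (by rintro _ ⟨B, -, rfl⟩; exact B.2.compl) (by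
        rintro _ ⟨B, hB, rfl⟩ _ ⟨B', hB', rfl⟩ hne
        have hlt : ∀ B B' : {B : Set Ω // MeasurableSet B}, μ B.1 < μ B'.1 →
            μ (B'.1)ᶜ < μ (B.1)ᶜ := by
          intro B B' h
          by_contra hle
          have h3 := ENNReal.add_lt_add_of_lt_of_le (measure_ne_top μ _) h (not_lt.mp hle)
          rw [measure_add_measure_compl B.2, measure_add_measure_compl B'.2] at h3
          exact lt_irrefl _ h3
        rcases hspec.1 hB.1 hB'.1 (fun h => hne (by rw [h])) with h | h
        · exact Or.inr ⟨compl_subset_compl.mpr h.1, hlt _ _ h.2⟩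
        · exact Or.inl ⟨compl_subset_compl.mpr h.1, hlt _ _ h.2⟩)
    have hLU : L ⊆ Uᶜ := by
      apply hLl
      rintro _ ⟨B, hB, rfl⟩
      rw [subset_compl_comm]
      apply hUl
      rintro _ ⟨B', hB', rfl⟩
      exact compl_subset_compl.mpr (hcomp B hB.1 B' hB'.1 (hB.2.trans hB'.2))
    have hLc' : μ L ≤ c := hLc c (by rintro _ ⟨B, hB, rfl⟩; exact hB.2.le)
    have hUc' : c ≤ μ Uᶜ := by
      have h1 : μ U ≤ μ univ - c := by
        apply hUc
        rintro _ ⟨B, hB, rfl⟩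
        simp only
        rw [measure_compl B.2 (measure_ne_top _ _)]
        exact tsub_le_tsub_left hB.2.le _
      rw [measure_compl hUm (measure_ne_top _ _)]
      apply ENNReal.le_sub_of_add_le_left (measure_ne_top _ _)
      calc μ U + c ≤ (μ univ - c) + c := by gcongr
        _ = μ univ := tsub_add_cancel_of_le hc
    have key : ∀ D, MeasurableSet D → L ⊆ D → D ⊆ Uᶜ →
        (∀ B ∈ C, μ B.1 < c → μ B.1 < μ D) → (∀ B ∈ C, c < μ B.1 → μ D < μ B.1) → False := by
      intro D hDm hLD hDU h1 h2
      have hD : (⟨D, hDm⟩ : {B : Set Ω // MeasurableSet B}) ∈ C := by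
        apply hins
        intro B hB
        rcases lt_or_gt_of_ne (hno B hB) with h | h
        · exact Or.inl ⟨(hLub _ ⟨B, ⟨hB, h⟩, rfl⟩).trans hLD, h1 B hB h⟩
        · refine Or.inr ⟨hDU.trans ?_, h2 B hB h⟩
          rw [compl_subset_comm]
          exact hUub _ ⟨B, ⟨hB, h⟩, rfl⟩
      rcases lt_or_gt_of_ne (hno _ hD) with h | h
      · exact lt_irrefl _ (h1 _ hD h)
      · exact lt_irrefl _ (h2 _ hD h)
    have hBL : ∀ B ∈ C, μ B.1 < c → μ B.1 ≤ μ L := fun B hB h =>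
      measure_mono (hLub _ ⟨B, ⟨hB, h⟩, rfl⟩)
    have hBU : ∀ B ∈ C, c < μ B.1 → μ Uᶜ ≤ μ B.1 := fun B hB h =>
      measure_mono (by rw [compl_subset_comm]; exact hUub _ ⟨B, ⟨hB, h⟩, rfl⟩)
    rcases (hLc'.trans hUc').lt_or_eq with hlt | heq
    · have hdiff : 0 < μ (Uᶜ \ L) := by
        rw [measure_sdiff hLU hLm.nullMeasurableSet (measure_ne_top _ _)]
        exact tsub_pos_of_lt hlt
      obtain ⟨E, hE, hEm, hE0, hE1⟩ := hna _ (hUm.compl.diff hLm) hdiff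
      have hdisj : Disjoint L E := (disjoint_sdiff_right).mono_right hE
      have hmeas : μ (L ∪ E) = μ L + μ E := measure_union hdisj hEm
      have h1 : μ L < μ (L ∪ E) := by
        rw [hmeas]; exact ENNReal.lt_add_right (measure_ne_top _ _) hE0.ne'
      have h2 : μ (L ∪ E) < μ Uᶜ := by
        rw [hmeas]
        calc μ L + μ E < μ L + μ (Uᶜ \ L) := by
              exact (ENNReal.add_lt_add_iff_left (measure_ne_top _ _)).mpr hE1
          _ = μ Uᶜ := by
              rw [measure_sdiff hLU hLm.nullMeasurableSet (measure_ne_top _ _)]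
              exact add_tsub_cancel_of_le hlt.le
      exact key (L ∪ E) (hLm.union hEm) subset_union_left
        (union_subset hLU (hE.trans sdiff_subset))
        (fun B hB h => (hBL B hB h).trans_lt h1) (fun B hB h => h2.trans_le (hBU B hB h))
    · have hL : μ L = c := le_antisymm hLc' (hUc'.trans heq.symm.le)
      exact key L hLm subset_rfl hLU (fun B hB h => by rwa [hL]) (fun B hB h => by rwa [hL])
  choose! G hG hGv using hval
  refine ⟨fun c => (G c).1, fun c hc => ⟨(G c).2, hGv c hc⟩, ?_⟩
  intro c d hcd hd
  rcases hcd.lt_or_eq with h | h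
  · apply hcomp _ (hG c (hcd.trans hd)) _ (hG d hd)
    rw [hGv c (hcd.trans hd), hGv d hd]; exact h
  · rw [h]

lemma nonatomic_restrict {Ω : Type*} [MeasurableSpace Ω] (μ : Measure Ω)
    (hna : Nonatomic μ) (A : Set Ω) (hA : MeasurableSet A) : Nonatomic (μ.restrict A) := by
  intro B hB h
  rw [Measure.restrict_apply hB] at h ⊢
  obtain ⟨D, hD, hDm, hD0, hD1⟩ := hna (B ∩ A) (hB.inter hA) h
  have : μ.restrict A D = μ D := by
    rw [Measure.restrict_apply hDm, inter_eq_left.mpr (hD.trans inter_subset_right)]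
  exact ⟨D, hD.trans inter_subset_left, hDm, by rwa [this], by rwa [this]⟩

/-- Splitting a nonatomic measure space into pieces of prescribed masses. -/
lemma split_masses {Ω ι : Type*} [MeasurableSpace Ω] (m : ι → ℝ≥0∞) (s : Finset ι)
    (hs : s.Nonempty) :
    ∀ (μ : Measure Ω) [IsFiniteMeasure μ], Nonatomic μ → ∑ i ∈ s, m i = μ univ →
    ∃ g : Ω → ι, (∀ ω, g ω ∈ s) ∧ (∀ i, MeasurableSet (g ⁻¹' {i})) ∧
      ∀ i ∈ s, μ (g ⁻¹' {i}) = m i := by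
  classical
  induction hs using Finset.Nonempty.cons_induction with
  | singleton a =>
    intro μ _ hna hsum
    refine ⟨fun _ => a, by simp, fun i => (MeasurableSet.const (a ∈ ({i} : Set _))), ?_⟩
    intro i hi
    rw [Finset.mem_singleton] at hi
    subst hi
    simp only [Finset.sum_singleton] at hsum
    rw [hsum]
    congr 1
    ext; simp
  | cons a s ha hs ih =>
    intro μ _ hna hsum
    rw [Finset.sum_cons] at hsum
    obtain ⟨F, hF, -⟩ := sierpinski μ hna
    obtain ⟨hBm, hBa⟩ := hF (m a) (hsum ▸ le_self_add)
    set B := F (m a)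
    have hsum' : ∑ i ∈ s, m i = μ.restrict Bᶜ univ := by
      rw [Measure.restrict_apply MeasurableSet.univ, univ_inter]
      have h1 := measure_add_measure_compl (μ := μ) hBm
      rw [hBa, ← hsum] at h1
      have hat : m a ≠ ∞ := by rw [← hBa]; exact measure_ne_top _ _
      exact ((ENNReal.add_right_inj hat).mp h1).symm
    obtain ⟨g, hgs, hgm, hg⟩ := ih (μ.restrict Bᶜ) (nonatomic_restrict μ hna _ hBm.compl) hsum'
    have hpre : ∀ i, i ≠ a → (fun ω => if ω ∈ B then a else g ω) ⁻¹' {i} = g ⁻¹' {i} ∩ Bᶜ := by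
      intro i hi
      ext ω
      by_cases h : ω ∈ B <;> simp [h, hi.symm]
    have hprea : (fun ω => if ω ∈ B then a else g ω) ⁻¹' {a} = B := by
      ext ω
      by_cases h : ω ∈ B
      · simp [h]
      · have : g ω ≠ a := fun h' => ha (h' ▸ hgs ω)
        simp [h, this]
    refine ⟨fun ω => if ω ∈ B then a else g ω, ?_, ?_, ?_⟩
    · intro ω
      by_cases h : ω ∈ B
      · simp [h]
      · simp [h, hgs ω]
    · intro i
      by_cases hi : i = a
      · rw [hi, hprea]; exact hBm
      · rw [hpre i hi]; exact (hgm i).inter hBm.compl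
    · intro i hi
      by_cases hia : i = a
      · rw [hia, hprea, hBa]
      · rw [hpre i hia, ← Measure.restrict_apply (hgm i)]
        apply hg
        rw [Finset.mem_cons] at hi
        exact hi.resolve_left hia

/-- An increasing family of events, independent of a given finitely-valued variable. -/
lemma indep_family {Ω κ : Type*} [MeasurableSpace Ω] (P : Measure Ω) [IsProbabilityMeasure P]
    (hna : Nonatomic P) (h : Ω → κ) (hfin : (range h).Finite)
    (hm : ∀ k, MeasurableSet (h ⁻¹' {k})) :
    ∃ A : ℝ → Set Ω, A 0 = ∅ ∧ A 1 = univ ∧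
      (∀ u ∈ Icc (0:ℝ) 1, MeasurableSet (A u)) ∧
      (∀ u ∈ Icc (0:ℝ) 1, ∀ v ∈ Icc (0:ℝ) 1, u ≤ v → A u ⊆ A v) ∧
      (∀ u ∈ Icc (0:ℝ) 1, ∀ T : Set κ, P (h ⁻¹' T ∩ A u) = ENNReal.ofReal u * P (h ⁻¹' T)) := by
  classical
  have hex : ∀ k, ∃ F : ℝ≥0∞ → Set Ω, (∀ c ≤ P (h ⁻¹' {k}), MeasurableSet (F c) ∧
      P (h ⁻¹' {k} ∩ F c) = c) ∧ ∀ c d, c ≤ d → d ≤ P (h ⁻¹' {k}) → F c ⊆ F d := by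
    intro k
    obtain ⟨F, h1, h2⟩ := sierpinski _ (nonatomic_restrict P hna _ (hm k))
    rw [Measure.restrict_apply MeasurableSet.univ, univ_inter] at h1 h2
    refine ⟨F, fun c hc => ⟨(h1 c hc).1, ?_⟩, h2⟩
    rw [inter_comm, ← Measure.restrict_apply (h1 c hc).1]
    exact (h1 c hc).2
  choose F hF hFmono using hex
  have hle : ∀ u ∈ Icc (0:ℝ) 1, ∀ k, ENNReal.ofReal u * P (h ⁻¹' {k}) ≤ P (h ⁻¹' {k}) := by
    intro u hu k
    calc ENNReal.ofReal u * P (h ⁻¹' {k}) ≤ 1 * P (h ⁻¹' {k}) := by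
          gcongr; exact ENNReal.ofReal_le_one.mpr hu.2
      _ = _ := one_mul _
  let G : ℝ → Set Ω := fun u => {ω | ω ∈ F (h ω) (ENNReal.ofReal u * P (h ⁻¹' {h ω}))}
  have hGk : ∀ u k, h ⁻¹' {k} ∩ G u = h ⁻¹' {k} ∩ F k (ENNReal.ofReal u * P (h ⁻¹' {k})) := by
    intro u k
    ext ω
    simp only [mem_inter_iff, mem_preimage, mem_singleton_iff, and_congr_right_iff, G]
    rintro rfl
    rfl
  have hdecomp : ∀ T : Set κ, ∀ D : Set Ω, h ⁻¹' T ∩ D =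
      ⋃ k ∈ hfin.toFinset.filter (· ∈ T), (h ⁻¹' {k} ∩ D) := by
    intro T D
    ext ω
    simp only [mem_inter_iff, mem_preimage, mem_iUnion, Finset.mem_filter,
      Set.Finite.mem_toFinset, mem_range, mem_singleton_iff, exists_prop]
    constructor
    · rintro ⟨h1, h2⟩; exact ⟨h ω, ⟨⟨ω, rfl⟩, h1⟩, rfl, h2⟩
    · rintro ⟨k, ⟨-, h1⟩, rfl, h2⟩; exact ⟨h1, h2⟩
  have hGm : ∀ u ∈ Icc (0:ℝ) 1, MeasurableSet (G u) := by
    intro u hu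
    have := hdecomp univ (G u)
    rw [preimage_univ, univ_inter] at this
    rw [this]
    refine Finset.measurableSet_biUnion _ fun k _ => ?_
    rw [hGk]
    exact (hm k).inter (hF k _ (hle u hu k)).1
  have hsum : ∀ T : Set κ, ∀ D : Set Ω, MeasurableSet D → P (h ⁻¹' T ∩ D) =
      ∑ k ∈ hfin.toFinset.filter (· ∈ T), P (h ⁻¹' {k} ∩ D) := by
    intro T D hD
    rw [hdecomp, measure_biUnion_finset]
    · intro i _ j _ hij
      refine Disjoint.mono inter_subset_left inter_subset_left ?_
      exact Disjoint.preimage _ (by simpa using hij)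
    · intro k _
      exact (hm k).inter hD
  have hGP : ∀ u ∈ Icc (0:ℝ) 1, ∀ T : Set κ,
      P (h ⁻¹' T ∩ G u) = ENNReal.ofReal u * P (h ⁻¹' T) := by
    intro u hu T
    have h1 := hsum T univ MeasurableSet.univ
    simp only [inter_univ] at h1
    rw [hsum T _ (hGm u hu), h1, Finset.mul_sum]
    refine Finset.sum_congr rfl fun k _ => ?_
    rw [hGk]
    exact (hF k _ (hle u hu k)).2
  refine ⟨fun u => if u = 0 then ∅ else if u = 1 then univ else G u, by simp, by simp, ?_, ?_, ?_⟩
  · intro u hu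
    dsimp only
    split_ifs
    · exact MeasurableSet.empty
    · exact MeasurableSet.univ
    · exact hGm u hu
  · intro u hu v hv huv
    dsimp only
    by_cases h0 : u = 0
    · simp [h0]
    by_cases h1 : v = 1
    · simp [h1]
    have h2 : v ≠ 0 := fun h => h0 (le_antisymm (h ▸ huv) hu.1)
    have h3 : u ≠ 1 := fun h => h1 (le_antisymm hv.2 (h ▸ huv))
    simp only [h0, h1, h2, h3, if_false]
    intro ω hω
    refine hFmono (h ω) _ _ ?_ (hle v hv _) hω
    gcongr
  · intro u hu T
    dsimp only
    split_ifs with h0 h1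
    · simp [h0]
    · simp [h1]
    · exact hGP u hu T

/-- Approximate finite transport (deficiency version of Hall's theorem, discretized). -/
lemma partial_transport {κ ι : Type} [Fintype κ] [Fintype ι]
    (E : κ → ι → Prop) (p : κ → ℝ) (c : ι → ℝ) (hp : ∀ k, 0 ≤ p k) (hc : ∀ i, 0 ≤ c i)
    (hp1 : ∑ k, p k = 1) (ε η : ℝ) (hε : 0 ≤ ε) (hη : 0 < η)
    (hall : ∀ T : Finset κ, ∀ U : Finset ι, (∀ i, i ∈ U ↔ ∃ k ∈ T, E k i) →
      ∑ k ∈ T, p k ≤ ∑ i ∈ U, c i + ε) :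
    ∃ w : κ → ι → ℝ, (∀ k i, 0 ≤ w k i) ∧ (∀ k i, ¬ E k i → w k i = 0) ∧
      (∀ k, ∑ i, w k i ≤ p k) ∧ (∀ i, ∑ k, w k i ≤ c i) ∧
      1 - ∑ k, ∑ i, w k i ≤ ε + η := by
  classical
  obtain ⟨N, hN⟩ := exists_nat_gt (max 1 ((Fintype.card κ + Fintype.card ι + 1) / η))
  have hN0 : (0:ℝ) < N := lt_of_lt_of_le one_pos ((le_max_left _ _).trans hN.le)
  have hNη : (Fintype.card κ + Fintype.card ι + 1 : ℝ) ≤ N * η := by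
    have := ((le_max_right _ _).trans hN.le)
    rwa [div_le_iff₀ hη] at this
  let D : ℕ := ⌈N * ε⌉₊ + Fintype.card ι
  let Piece := (k : κ) × Fin ⌊N * p k⌋₊
  let Slot := (i : ι) × Fin ⌊N * c i⌋₊
  let t : Piece → Finset (Slot ⊕ Fin D) := fun x =>
    (Finset.univ.filter fun i => E x.1 i).sigma (fun i => (Finset.univ : Finset (Fin ⌊N * c i⌋₊)))
      |>.disjSum Finset.univ
  have hallcond : ∀ s : Finset Piece, s.card ≤ (s.biUnion t).card := by
    intro s
    rcases s.eq_empty_or_nonempty with rfl | ⟨x0, hx0⟩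
    · simp
    let T : Finset κ := s.image Sigma.fst
    let U : Finset ι := Finset.univ.filter fun i => ∃ k ∈ T, E k i
    have h1 : s ⊆ T.sigma (fun k => (Finset.univ : Finset (Fin ⌊N * p k⌋₊))) := by
      intro x hx
      exact Finset.mem_sigma.mpr ⟨Finset.mem_image_of_mem _ hx, Finset.mem_univ _⟩
    have h2 : (s.card : ℝ) ≤ N * ∑ k ∈ T, p k := by
      have := Finset.card_le_card h1
      rw [Finset.card_sigma] at this
      simp only [Finset.card_univ, Fintype.card_fin] at this
      calc (s.card : ℝ) ≤ ((∑ k ∈ T, ⌊N * p k⌋₊ : ℕ) : ℝ) := by exact_mod_cast this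
        _ = ∑ k ∈ T, (⌊N * p k⌋₊ : ℝ) := by push_cast; rfl
        _ ≤ ∑ k ∈ T, N * p k := Finset.sum_le_sum fun k _ =>
            Nat.floor_le (mul_nonneg hN0.le (hp k))
        _ = _ := by rw [Finset.mul_sum]
    have h3 : (U.sigma (fun i => (Finset.univ : Finset (Fin ⌊N * c i⌋₊)))).disjSum
        (Finset.univ : Finset (Fin D)) ⊆ s.biUnion t := by
      intro y hy
      rw [Finset.mem_biUnion]
      rcases y with y | y
      · simp only [Finset.inl_mem_disjSum, Finset.mem_sigma, Finset.mem_univ, and_true, U,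
          Finset.mem_filter, true_and] at hy
        obtain ⟨k, hk, hE⟩ := hy
        obtain ⟨x, hx, rfl⟩ := Finset.mem_image.mp hk
        refine ⟨x, hx, ?_⟩
        simp [t, hE]
      · exact ⟨x0, hx0, by simp [t]⟩
    have h4 := Finset.card_le_card h3
    rw [Finset.card_disjSum, Finset.card_sigma] at h4
    simp only [Finset.card_univ, Fintype.card_fin] at h4
    have h5 : (N : ℝ) * ∑ i ∈ U, c i ≤ (∑ i ∈ U, ⌊N * c i⌋₊ : ℕ) + Fintype.card ι := by
      calc (N : ℝ) * ∑ i ∈ U, c i = ∑ i ∈ U, N * c i := by rw [Finset.mul_sum]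
        _ ≤ ∑ i ∈ U, ((⌊N * c i⌋₊ : ℝ) + 1) := Finset.sum_le_sum fun i _ =>
            (Nat.lt_floor_add_one _).le
        _ = (∑ i ∈ U, ⌊N * c i⌋₊ : ℕ) + (U.card : ℝ) := by
            rw [Finset.sum_add_distrib]; simp
        _ ≤ _ := by
            gcongr; exact Finset.card_le_univ U
    have h6 := hall T U (by intro i; simp [U])
    have h7 : (s.card : ℝ) ≤ ((s.biUnion t).card : ℝ) := by
      calc (s.card : ℝ) ≤ N * (∑ i ∈ U, c i + ε) := h2.trans (by gcongr)
        _ = N * ∑ i ∈ U, c i + N * ε := by ring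
        _ ≤ ((∑ i ∈ U, ⌊N * c i⌋₊ : ℕ) + Fintype.card ι) + (⌈N * ε⌉₊ : ℝ) :=
            add_le_add h5 (Nat.le_ceil _)
        _ = ((∑ i ∈ U, ⌊N * c i⌋₊ + D : ℕ) : ℝ) := by simp only [D]; push_cast; ring
        _ ≤ _ := by exact_mod_cast h4
    exact_mod_cast h7
  obtain ⟨f, hfinj, hft⟩ :=
    (Finset.all_card_le_biUnion_card_iff_exists_injective t).mp hallcond
  let M : κ → ι → Finset Piece := fun k i =>
    Finset.univ.filter fun x => x.1 = k ∧ ∃ j, f x = Sum.inl ⟨i, j⟩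
  have hdisjI : ∀ k, ∀ i i', i ≠ i' → Disjoint (M k i) (M k i') := by
    intro k i i' hne
    rw [Finset.disjoint_left]
    intro x hx hx'
    simp only [M, Finset.mem_filter, Finset.mem_univ, true_and] at hx hx'
    obtain ⟨-, j, hj⟩ := hx
    obtain ⟨-, j', hj'⟩ := hx'
    rw [hj] at hj'
    have := Sum.inl.inj hj'
    exact hne (congrArg Sigma.fst this)
  have hdisjK : ∀ k k' i i', k ≠ k' → Disjoint (M k i) (M k' i') := by
    intro k k' i i' hne
    rw [Finset.disjoint_left]
    intro x hx hx'
    simp only [M, Finset.mem_filter, Finset.mem_univ, true_and] at hx hx'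
    exact hne (hx.1.symm.trans hx'.1)
  have hrow : ∀ k, ∑ i, (M k i).card ≤ ⌊N * p k⌋₊ := by
    intro k
    rw [← Finset.card_biUnion (fun i _ i' _ h => hdisjI k i i' h)]
    calc _ ≤ (({k} : Finset κ).sigma
          (fun k => (Finset.univ : Finset (Fin ⌊N * p k⌋₊)))).card := by
          apply Finset.card_le_card
          intro x hx
          simp only [M, Finset.mem_biUnion, Finset.mem_filter, Finset.mem_univ, true_and] at hx
          obtain ⟨i, h, -⟩ := hx
          exact Finset.mem_sigma.mpr ⟨Finset.mem_singleton.mpr h, Finset.mem_univ _⟩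
      _ = _ := by simp
  have hcol : ∀ i, ∑ k, (M k i).card ≤ ⌊N * c i⌋₊ := by
    intro i
    rw [← Finset.card_biUnion (fun k _ k' _ h => hdisjK k k' i i h)]
    calc _ ≤ ((({i} : Finset ι).sigma
          (fun i => (Finset.univ : Finset (Fin ⌊N * c i⌋₊)))).map
            (Function.Embedding.inl : Slot ↪ Slot ⊕ Fin D)).card := by
          apply Finset.card_le_card_of_injOn f _ hfinj.injOn
          intro x hx
          simp only [M, Finset.coe_biUnion, Finset.mem_coe, Finset.mem_univ, Set.iUnion_true,
            Set.mem_iUnion, Finset.mem_filter, true_and] at hx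
          obtain ⟨k, -, j, hj⟩ := hx
          rw [hj]
          exact Finset.mem_map_of_mem Function.Embedding.inl (Finset.mem_sigma.mpr
            ⟨Finset.mem_singleton_self i, Finset.mem_univ j⟩)
      _ = _ := by rw [Finset.card_map, Finset.card_sigma]; simp
  have htot : (Fintype.card Piece) ≤ ∑ k, ∑ i, (M k i).card + D := by
    have h1 : (Finset.univ : Finset Piece) ⊆
        (Finset.univ : Finset (κ × ι)).biUnion (fun z => M z.1 z.2) ∪
        Finset.univ.filter (fun x => ∃ d, f x = Sum.inr d) := by
      intro x _
      rw [Finset.mem_union]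
      rcases hx : f x with ⟨i, j⟩ | d
      · left
        rw [Finset.mem_biUnion]
        exact ⟨(x.1, i), Finset.mem_univ _, by simp [M, hx]⟩
      · right; simp [hx]
    have h2 := (Finset.card_le_card h1).trans (Finset.card_union_le _ _)
    rw [Finset.card_univ] at h2
    refine h2.trans (add_le_add ?_ ?_)
    · refine Finset.card_biUnion_le.trans ?_
      rw [Fintype.sum_prod_type]
    · calc _ ≤ ((Finset.univ : Finset (Fin D)).map
            (Function.Embedding.inr : Fin D ↪ Slot ⊕ Fin D)).card := by
            apply Finset.card_le_card_of_injOn f _ hfinj.injOn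
            intro x hx
            simp only [Finset.coe_filter, Finset.mem_univ, true_and, Set.mem_ofPred_eq] at hx
            obtain ⟨d, hd⟩ := hx
            rw [hd]; simp
        _ = D := by simp
  have hpieces : (N : ℝ) ≤ Fintype.card Piece + Fintype.card κ := by
    calc (N : ℝ) = ∑ k, N * p k := by rw [← Finset.mul_sum, hp1, mul_one]
      _ ≤ ∑ k, ((⌊N * p k⌋₊ : ℝ) + 1) := Finset.sum_le_sum fun i _ =>
            (Nat.lt_floor_add_one _).le
      _ = _ := by
        rw [Finset.sum_add_distrib]; simp [Piece]
  refine ⟨fun k i => (M k i).card / N, fun k i => by positivity, ?_, ?_, ?_, ?_⟩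
  · intro k i hE
    have : M k i = ∅ := by
      rw [Finset.eq_empty_iff_forall_notMem]
      intro x hx
      simp only [M, Finset.mem_filter, Finset.mem_univ, true_and] at hx
      obtain ⟨rfl, j, hj⟩ := hx
      have := hft x
      rw [hj] at this
      simp [t] at this
      exact hE this
    simp [this]
  · intro k
    rw [← Finset.sum_div, div_le_iff₀ hN0, mul_comm]
    calc (∑ i, ((M k i).card : ℝ)) ≤ (⌊N * p k⌋₊ : ℝ) := by exact_mod_cast hrow k
      _ ≤ _ := Nat.floor_le (mul_nonneg hN0.le (hp k))
  · intro i
    rw [← Finset.sum_div, div_le_iff₀ hN0, mul_comm]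
    calc (∑ k, ((M k i).card : ℝ)) ≤ (⌊N * c i⌋₊ : ℝ) := by exact_mod_cast hcol i
      _ ≤ _ := Nat.floor_le (mul_nonneg hN0.le (hc i))
  · simp only [← Finset.sum_div]
    have h1 : (Fintype.card Piece : ℝ) ≤ ∑ k, ∑ i, ((M k i).card : ℝ) + D := by
      exact_mod_cast htot
    have h2 : (D : ℝ) ≤ N * ε + 1 + Fintype.card ι := by
      have := (Nat.ceil_lt_add_one (mul_nonneg hN0.le hε)).le
      simp only [D]; push_cast; linarith
    rw [sub_le_iff_le_add, ← sub_le_iff_le_add', le_div_iff₀ hN0]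
    nlinarith

lemma full_transport {κ ι : Type} [Fintype κ] [Fintype ι]
    (E : κ → ι → Prop) (p : κ → ℝ) (c : ι → ℝ) (hp : ∀ k, 0 ≤ p k) (hc : ∀ i, 0 ≤ c i)
    (hp1 : ∑ k, p k = 1) (hc1 : ∑ i, c i = 1) (ε η : ℝ) (hε : 0 ≤ ε) (hη : 0 < η)
    (hall : ∀ T : Finset κ, ∀ U : Finset ι, (∀ i, i ∈ U ↔ ∃ k ∈ T, E k i) →
      ∑ k ∈ T, p k ≤ ∑ i ∈ U, c i + ε) :
    ∃ w : κ → ι → ℝ, (∀ k i, 0 ≤ w k i) ∧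
      (∀ k, ∑ i, w k i = p k) ∧ (∀ i, ∑ k, w k i = c i) ∧
      ∀ B : Finset (κ × ι), (∀ z ∈ B, ¬ E z.1 z.2) → ∑ z ∈ B, w z.1 z.2 ≤ ε + η := by
  obtain ⟨w, hw0, hwE, hwr, hwc, hwt⟩ := partial_transport E p c hp hc hp1 ε η hε hη hall
  set q := 1 - ∑ k, ∑ i, w k i with hq
  let a : κ → ℝ := fun k => p k - ∑ i, w k i
  let b : ι → ℝ := fun i => c i - ∑ k, w k i
  have ha0 : ∀ k, 0 ≤ a k := fun k => sub_nonneg.mpr (hwr k)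
  have hb0 : ∀ i, 0 ≤ b i := fun i => sub_nonneg.mpr (hwc i)
  have ha : ∑ k, a k = q := by simp only [a, Finset.sum_sub_distrib, hp1, hq]
  have hb : ∑ i, b i = q := by
    simp only [b, Finset.sum_sub_distrib, hc1, hq]; rw [Finset.sum_comm]
  have hq0 : 0 ≤ q := ha ▸ Finset.sum_nonneg fun k _ => ha0 k
  have haq : ∀ k, a k * q / q = a k := by
    intro k
    by_cases h : q = 0
    · rw [h] at ha
      have := (Finset.sum_eq_zero_iff_of_nonneg fun k _ => ha0 k).mp ha k (Finset.mem_univ k)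
      simp [this]
    · field_simp
  have hbq : ∀ i, q * b i / q = b i := by
    intro i
    by_cases h : q = 0
    · rw [h] at hb
      have := (Finset.sum_eq_zero_iff_of_nonneg fun k _ => hb0 k).mp hb i (Finset.mem_univ i)
      simp [this]
    · field_simp
  have hnn : ∀ k i, 0 ≤ a k * b i / q := fun k i => div_nonneg (mul_nonneg (ha0 k) (hb0 i)) hq0
  refine ⟨fun k i => w k i + a k * b i / q, fun k i => add_nonneg (hw0 k i) (hnn k i), ?_, ?_, ?_⟩
  · intro k
    rw [Finset.sum_add_distrib, ← Finset.sum_div, ← Finset.mul_sum, hb, haq]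
    simp [a]
  · intro i
    rw [Finset.sum_add_distrib, ← Finset.sum_div, ← Finset.sum_mul, ha, hbq]
    simp [b]
  · intro B hB
    calc ∑ z ∈ B, (w z.1 z.2 + a z.1 * b z.2 / q) = ∑ z ∈ B, a z.1 * b z.2 / q :=
          Finset.sum_congr rfl fun z hz => by rw [hwE _ _ (hB z hz), zero_add]
      _ ≤ ∑ z : κ × ι, a z.1 * b z.2 / q :=
          Finset.sum_le_sum_of_subset_of_nonneg (Finset.subset_univ _) fun z _ _ => hnn _ _
      _ = q := by
          rw [Fintype.sum_prod_type]
          simp only [← Finset.sum_div, ← Finset.mul_sum, hb]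
          simp only [← Finset.sum_mul, ha]
          by_cases h : q = 0
          · simp [h]
          · field_simp
      _ ≤ ε + η := hwt

lemma strassen_finite {Ω S : Type*} [MeasurableSpace Ω] [MeasurableSpace S] [MetricSpace S]
    [BorelSpace S] (P : Measure Ω) [IsProbabilityMeasure P] (hna : Nonatomic P)
    (X : Ω → S) (hX : Measurable X) (n : ℕ) (c : Fin n → ℝ≥0∞) (a : Fin n → S)
    (hc : ∑ i, c i = 1) (ν : Measure S) (hν : ν = ∑ i, c i • Measure.dirac (a i))
    (ε η : ℝ) (hε : 0 < ε) (hη : 0 < η)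
    (hLP : levyProkhorovDist (P.map X) ν < ε) :
    ∃ Y : Ω → S, Measurable Y ∧ (range Y).Finite ∧ P.map Y = ν ∧
      P {ω | ε ≤ dist (X ω) (Y ω)} ≤ ENNReal.ofReal (ε + η) := by
  classical
  have hνapp : ∀ V : Set S, MeasurableSet V →
      ν V = ∑ i ∈ Finset.univ.filter (fun i => a i ∈ V), c i := by
    intro V hV
    rw [hν, Finset.sum_filter]
    simp only [Measure.coe_finsetSum, Finset.sum_apply, Measure.smul_apply,
      Measure.dirac_apply' _ hV, smul_eq_mul]
    refine Finset.sum_congr rfl fun i _ => ?_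
    by_cases h : a i ∈ V <;> simp [h]
  have hctop : ∀ i, c i ≠ ∞ := by
    intro i
    have : c i ≤ 1 := hc ▸ Finset.single_le_sum (fun _ _ => zero_le) (Finset.mem_univ i)
    exact ne_top_of_le_ne_top ENNReal.one_ne_top this
  have : IsProbabilityMeasure (P.map X) := Measure.isProbabilityMeasure_map hX.aemeasurable
  have : IsProbabilityMeasure ν := ⟨by rw [hνapp univ MeasurableSet.univ]; simpa using hc⟩
  have hLP' : levyProkhorovEDist (P.map X) ν < ENNReal.ofReal ε := by
    rw [ENNReal.lt_ofReal_iff_toReal_lt (levyProkhorovEDist_ne_top _ _)]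
    exact hLP
  let σ : S → Finset (Fin n) := fun x => Finset.univ.filter fun i => dist x (a i) < ε
  have hσ1 : ∀ J, MeasurableSet (σ ⁻¹' {J}) := by
    intro J
    have : σ ⁻¹' {J} = ⋂ i, {x | dist x (a i) < ε ↔ i ∈ J} := by
      ext x
      simp [σ, Finset.ext_iff]
    rw [this]
    refine MeasurableSet.iInter fun i => ?_
    have hb : MeasurableSet {x | dist x (a i) < ε} := (Metric.isOpen_ball (x := a i)).measurableSet
    by_cases h : i ∈ J
    · simpa [h] using hb
    · simp only [h, iff_false]; exact hb.compl
  let τ : Ω → Finset (Fin n) := fun ω => σ (X ω)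
  have hτ1 : ∀ J, MeasurableSet (τ ⁻¹' {J}) := fun J => hX (hσ1 J)
  have hτsum : ∀ T : Finset (Finset (Fin n)),
      ∑ J ∈ T, P (τ ⁻¹' {J}) = P (τ ⁻¹' (T : Set (Finset (Fin n)))) := fun T =>
    sum_measure_preimage_singleton T fun J _ => hτ1 J
  obtain ⟨w, hw0, hwr, hwc, hwB⟩ := full_transport (κ := Finset (Fin n)) (ι := Fin n)
    (fun J i => i ∈ J) (fun J => (P (τ ⁻¹' {J})).toReal) (fun i => (c i).toReal)
    (fun _ => ENNReal.toReal_nonneg) (fun _ => ENNReal.toReal_nonneg)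
    (by
      rw [← ENNReal.toReal_sum (fun _ _ => measure_ne_top _ _), hτsum]
      simp)
    (by
      rw [← ENNReal.toReal_sum (fun i _ => hctop i), hc]; simp)
    ε η hε.le hη (by
      intro T U hU
      have hBm : MeasurableSet (σ ⁻¹' (T : Set (Finset (Fin n)))) := by
        have : σ ⁻¹' (T : Set (Finset (Fin n))) = ⋃ J ∈ T, σ ⁻¹' {J} := by
          ext x; simp
        rw [this]
        exact Finset.measurableSet_biUnion _ fun J _ => hσ1 J
      have h1 := left_measure_le_of_levyProkhorovEDist_lt hLP' hBm
      rw [ENNReal.toReal_ofReal hε.le, Measure.map_apply hX hBm,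
        hνapp _ Metric.isOpen_thickening.measurableSet] at h1
      have h2 : ∑ i ∈ Finset.univ.filter (fun i => a i ∈ Metric.thickening ε
          (σ ⁻¹' (T : Set (Finset (Fin n))))), c i ≤ ∑ i ∈ U, c i := by
        apply Finset.sum_le_sum_of_subset
        intro i hi
        rw [Finset.mem_filter] at hi
        obtain ⟨x, hx, hd⟩ := Metric.mem_thickening_iff.mp hi.2
        rw [hU]
        refine ⟨σ x, hx, ?_⟩
        simp only [σ, Finset.mem_filter, Finset.mem_univ, true_and]
        rwa [dist_comm]
      have h3 : P (X ⁻¹' (σ ⁻¹' (T : Set (Finset (Fin n))))) ≤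
          ∑ i ∈ U, c i + ENNReal.ofReal ε := h1.trans (by gcongr)
      rw [← ENNReal.toReal_sum (fun _ _ => measure_ne_top _ _), hτsum,
        ← ENNReal.toReal_sum (fun i _ => hctop i)]
      have hUt : ∑ i ∈ U, c i ≠ ∞ := ENNReal.sum_ne_top.mpr fun i _ => hctop i
      have h4 := ENNReal.toReal_mono (ENNReal.add_ne_top.mpr ⟨hUt, ENNReal.ofReal_ne_top⟩) h3
      rw [ENNReal.toReal_add hUt ENNReal.ofReal_ne_top, ENNReal.toReal_ofReal hε.le] at h4
      exact h4)
  have hne : (Finset.univ : Finset (Fin n)).Nonempty := by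
    by_contra h
    rw [Finset.not_nonempty_iff_eq_empty] at h
    rw [h] at hc
    simp at hc
  have hsplit : ∀ J : Finset (Fin n), ∃ g : Ω → Fin n, (∀ i, MeasurableSet (g ⁻¹' {i})) ∧
      ∀ i, P (τ ⁻¹' {J} ∩ g ⁻¹' {i}) = ENNReal.ofReal (w J i) := by
    intro J
    obtain ⟨g, -, hgm, hg⟩ := split_masses (fun i => ENNReal.ofReal (w J i)) Finset.univ hne
      (P.restrict (τ ⁻¹' {J})) (nonatomic_restrict P hna _ (hτ1 J)) (by
        rw [← ENNReal.ofReal_sum_of_nonneg (fun i _ => hw0 J i), hwr J,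
          ENNReal.ofReal_toReal (measure_ne_top _ _),
          Measure.restrict_apply MeasurableSet.univ, univ_inter])
    refine ⟨g, hgm, fun i => ?_⟩
    rw [inter_comm, ← Measure.restrict_apply (hgm i)]
    exact hg i (Finset.mem_univ i)
  choose g hgm hg using hsplit
  let z : Ω → Finset (Fin n) × Fin n := fun ω => (τ ω, g (τ ω) ω)
  have hzfib : ∀ J i, z ⁻¹' {(J, i)} = τ ⁻¹' {J} ∩ (g J) ⁻¹' {i} := by
    intro J i
    ext ω
    simp only [z, mem_preimage, mem_singleton_iff, Prod.mk.injEq, mem_inter_iff,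
      and_congr_right_iff]
    rintro rfl
    rfl
  have hzm1 : ∀ y, MeasurableSet (z ⁻¹' {y}) := by
    rintro ⟨J, i⟩
    rw [hzfib]; exact (hτ1 J).inter (hgm J i)
  have hzm : ∀ V : Finset (Finset (Fin n) × Fin n), MeasurableSet (z ⁻¹' (V : Set _)) := by
    intro V
    have : z ⁻¹' (V : Set _) = ⋃ y ∈ V, z ⁻¹' {y} := by ext; simp
    rw [this]
    exact Finset.measurableSet_biUnion _ fun y _ => hzm1 y
  have hzP : ∀ V : Finset (Finset (Fin n) × Fin n),
      P (z ⁻¹' (V : Set _)) = ENNReal.ofReal (∑ y ∈ V, w y.1 y.2) := by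
    intro V
    rw [← sum_measure_preimage_singleton V fun y _ => hzm1 y,
      ENNReal.ofReal_sum_of_nonneg (fun y _ => hw0 _ _)]
    refine Finset.sum_congr rfl ?_
    rintro ⟨J, i⟩ -
    rw [hzfib, hg]
  let Y : Ω → S := fun ω => a (z ω).2
  have hYpre : ∀ V : Set S, Y ⁻¹' V = z ⁻¹' (((Finset.univ : Finset (Finset (Fin n))) ×ˢ
      Finset.univ.filter (fun i => a i ∈ V) : Finset _) : Set _) := by
    intro V
    ext ω
    simp [Y]
  have hYm : Measurable Y := by
    intro V _
    rw [hYpre]; exact hzm _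
  refine ⟨Y, hYm, ?_, ?_, ?_⟩
  · refine (Set.finite_range a).subset ?_
    rintro _ ⟨ω, rfl⟩
    exact ⟨_, rfl⟩
  · ext V hV
    rw [Measure.map_apply hYm hV, hYpre, hzP, hνapp V hV, Finset.sum_product_right]
    simp only [hwc]
    rw [← ENNReal.toReal_sum (fun i _ => hctop i), ENNReal.ofReal_toReal]
    exact ENNReal.sum_ne_top.mpr fun i _ => hctop i
  · let B : Finset (Finset (Fin n) × Fin n) := Finset.univ.filter fun y => y.2 ∉ y.1
    calc P {ω | ε ≤ dist (X ω) (Y ω)} ≤ P (z ⁻¹' (B : Set _)) := by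
          apply measure_mono
          intro ω hω
          simp only [B, mem_preimage, Finset.coe_filter, Finset.mem_univ, true_and,
            Set.mem_ofPred_eq]
          intro hmem
          simp only [z, τ, σ, Finset.mem_filter, Finset.mem_univ, true_and] at hmem
          exact absurd hmem (not_lt.mpr hω)
      _ = ENNReal.ofReal (∑ y ∈ B, w y.1 y.2) := hzP B
      _ ≤ _ := by
          apply ENNReal.ofReal_le_ofReal
          apply hwB
          intro y hy
          exact (Finset.mem_filter.mp hy).2

lemma kyFan_nonempty {Ω S : Type*} [MeasurableSpace Ω] [PseudoMetricSpace S]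
    (P : Measure Ω) [IsProbabilityMeasure P] (X Y : Ω → S) :
    {ε : ℝ | 0 < ε ∧ (P {ω | ε ≤ dist (X ω) (Y ω)}).toReal ≤ ε}.Nonempty :=
  ⟨1, one_pos, measureReal_le_one⟩

lemma kyFan_le {Ω S : Type*} [MeasurableSpace Ω] [PseudoMetricSpace S]
    (P : Measure Ω) (X Y : Ω → S) (e : ℝ) (he : 0 < e)
    (h : P {ω | e ≤ dist (X ω) (Y ω)} ≤ ENNReal.ofReal e) : kyFanDist P X Y ≤ e := by
  refine csInf_le ⟨0, fun x hx => hx.1.le⟩ ⟨he, ?_⟩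
  exact ENNReal.toReal_le_of_le_ofReal he.le h

lemma le_of_kyFan_lt {Ω S : Type*} [MeasurableSpace Ω] [PseudoMetricSpace S]
    (P : Measure Ω) [IsProbabilityMeasure P] (X Y : Ω → S) (e : ℝ)
    (h : kyFanDist P X Y < e) : P {ω | e ≤ dist (X ω) (Y ω)} ≤ ENNReal.ofReal e := by
  obtain ⟨x, ⟨hx0, hx⟩, hxe⟩ := exists_lt_of_csInf_lt (kyFan_nonempty P X Y) h
  calc P {ω | e ≤ dist (X ω) (Y ω)} ≤ P {ω | x ≤ dist (X ω) (Y ω)} :=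
        measure_mono fun ω hω => hxe.le.trans hω
    _ ≤ ENNReal.ofReal x := (ENNReal.le_ofReal_iff_toReal_le (measure_ne_top _ _) hx0.le).mpr hx
    _ ≤ _ := ENNReal.ofReal_le_ofReal hxe.le

lemma dist_union {Ω S : Type*} [MeasurableSpace Ω] [PseudoMetricSpace S]
    (P : Measure Ω) (X Y Z : Ω → S) (e f : ℝ) :
    P {ω | e + f ≤ dist (X ω) (Z ω)} ≤
      P {ω | e ≤ dist (X ω) (Y ω)} + P {ω | f ≤ dist (Y ω) (Z ω)} := by
  refine (measure_mono ?_).trans (measure_union_le _ _)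
  intro ω hω
  by_contra hno
  simp only [mem_union, Set.mem_ofPred_eq, not_or, not_le] at hno hω
  linarith [dist_triangle (X ω) (Y ω) (Z ω)]

lemma uniform_osc {Ω S : Type*} [MeasurableSpace Ω] [PseudoMetricSpace S]
    (P : Measure Ω) [IsProbabilityMeasure P] (γ : ℝ → Ω → S)
    (hγ : KyFanContinuousOn P γ (Icc 0 1)) (e : ℝ) (he : 0 < e) :
    ∃ δ > 0, ∀ s ∈ Icc (0:ℝ) 1, ∀ t ∈ Icc (0:ℝ) 1, |s - t| < δ →
      P {ω | e ≤ dist (γ s ω) (γ t ω)} ≤ ENNReal.ofReal e := by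
  have hγ' : ∀ t : Icc (0:ℝ) 1, ∃ δ > 0, ∀ s ∈ Icc (0:ℝ) 1, |s - t| < δ →
      kyFanDist P (γ s) (γ t) < e / 2 := fun t => hγ t t.2 (e / 2) (by positivity)
  choose d hd0 hd using hγ'
  obtain ⟨δ, hδ, hleb⟩ := lebesgue_number_lemma_of_metric (s := Icc (0:ℝ) 1)
    (c := fun t : Icc (0:ℝ) 1 => Metric.ball (t:ℝ) (d t)) isCompact_Icc
    (fun _ => Metric.isOpen_ball)
    (fun t ht => mem_iUnion.mpr ⟨⟨t, ht⟩, Metric.mem_ball_self (hd0 _)⟩)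
  refine ⟨δ, hδ, fun s hs t ht hst => ?_⟩
  obtain ⟨i, hi⟩ := hleb s hs
  have h1 : |s - i| < d i := by
    have := hi (Metric.mem_ball_self hδ)
    rwa [Metric.mem_ball, Real.dist_eq] at this
  have h2 : |t - i| < d i := by
    have := hi (show t ∈ Metric.ball s δ by rw [Metric.mem_ball, Real.dist_eq, abs_sub_comm]; exact hst)
    rwa [Metric.mem_ball, Real.dist_eq] at this
  have h3 := le_of_kyFan_lt P _ _ _ (hd i s hs h1)
  have h4 := le_of_kyFan_lt P _ _ _ (hd i t ht h2)
  have h5 := dist_union P (γ s) (γ i) (γ t) (e / 2) (e / 2)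
  simp only [dist_comm (γ i _) (γ t _)] at h5
  rw [add_halves] at h5
  calc _ ≤ _ := h5
    _ ≤ ENNReal.ofReal (e / 2) + ENNReal.ofReal (e / 2) := add_le_add h3 h4
    _ = _ := by rw [← ENNReal.ofReal_add (by positivity) (by positivity), add_halves]

/-- Good path on `[a, b]` joining prescribed endpoint values. -/
def GoodPath {Ω S : Type*} [MeasurableSpace Ω] [MeasurableSpace S] [MetricSpace S]
    (P : Measure Ω) (β : ℝ → Measure S) (γ : ℝ → Ω → S) (Z : ℝ → Ω → S) (e : ℝ)
    (a b : ℝ) : Prop :=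
  ∃ y : ℝ → Ω → S, y a = Z a ∧ y b = Z b ∧ (∀ t ∈ Icc a b, Measurable (y t)) ∧
    KyFanContinuousOn P y (Icc a b) ∧ (∀ t ∈ Icc a b, P.map (y t) = β t) ∧
    ∀ t ∈ Icc a b, kyFanDist P (γ t) (y t) ≤ e

lemma GoodPath.trans {Ω S : Type*} [MeasurableSpace Ω] [MeasurableSpace S] [MetricSpace S]
    {P : Measure Ω} {β : ℝ → Measure S} {γ : ℝ → Ω → S} {Z : ℝ → Ω → S} {e : ℝ}
    {a b c : ℝ} (hab : a ≤ b) (hbc : b ≤ c) (h1 : GoodPath P β γ Z e a b)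
    (h2 : GoodPath P β γ Z e b c) : GoodPath P β γ Z e a c := by
  classical
  obtain ⟨y, ya, yb, ym, yc, yl, yd⟩ := h1
  obtain ⟨x, xb, xc', xm, xc, xl, xd⟩ := h2
  let u : ℝ → Ω → S := fun t => if t ≤ b then y t else x t
  have uy : ∀ t ≤ b, u t = y t := fun t ht => if_pos ht
  have ux : ∀ t, b ≤ t → u t = x t := by
    intro t ht
    rcases ht.lt_or_eq with h | h
    · exact if_neg (not_le.mpr h)
    · subst h; rw [uy _ le_rfl, yb, xb]
  refine ⟨u, by rw [uy a hab, ya], by rw [ux c hbc, xc'], ?_, ?_, ?_, ?_⟩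
  · intro t ht
    rcases le_total t b with h | h
    · rw [uy t h]; exact ym t ⟨ht.1, h⟩
    · rw [ux t h]; exact xm t ⟨h, ht.2⟩
  · intro t ht ε hε
    have hl : ∃ δ > 0, ∀ s ∈ Icc a b, |s - t| < δ → kyFanDist P (u s) (u t) < ε := by
      rcases le_or_gt t b with h | h
      · obtain ⟨δ, hδ, H⟩ := yc t ⟨ht.1, h⟩ ε hε
        refine ⟨δ, hδ, fun s hs hst => ?_⟩
        rw [uy s hs.2, uy t h]; exact H s hs hst
      · refine ⟨t - b, sub_pos.mpr h, fun s hs hst => ?_⟩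
        rw [abs_lt] at hst
        linarith [hs.2, hst.1]
    have hr : ∃ δ > 0, ∀ s ∈ Icc b c, |s - t| < δ → kyFanDist P (u s) (u t) < ε := by
      rcases le_or_gt b t with h | h
      · obtain ⟨δ, hδ, H⟩ := xc t ⟨h, ht.2⟩ ε hε
        refine ⟨δ, hδ, fun s hs hst => ?_⟩
        rw [ux s hs.1, ux t h]; exact H s hs hst
      · refine ⟨b - t, sub_pos.mpr h, fun s hs hst => ?_⟩
        rw [abs_lt] at hst
        linarith [hs.1, hst.2]
    obtain ⟨d1, hd1, H1⟩ := hl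
    obtain ⟨d2, hd2, H2⟩ := hr
    refine ⟨min d1 d2, lt_min hd1 hd2, fun s hs hst => ?_⟩
    rcases le_total s b with h | h
    · exact H1 s ⟨hs.1, h⟩ (hst.trans_le (min_le_left _ _))
    · exact H2 s ⟨h, hs.2⟩ (hst.trans_le (min_le_right _ _))
  · intro t ht
    rcases le_total t b with h | h
    · rw [uy t h]; exact yl t ⟨ht.1, h⟩
    · rw [ux t h]; exact xl t ⟨h, ht.2⟩
  · intro t ht
    rcases le_total t b with h | h
    · rw [uy t h]; exact yd t ⟨ht.1, h⟩
    · rw [ux t h]; exact xd t ⟨h, ht.2⟩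

lemma kyFan_self {Ω S : Type*} [MeasurableSpace Ω] [PseudoMetricSpace S]
    (P : Measure Ω) (X : Ω → S) (e : ℝ) (he : 0 < e) : kyFanDist P X X < e := by
  refine (kyFan_le P X X (e / 2) (by positivity) ?_).trans_lt (by linarith)
  have : {ω | e / 2 ≤ dist (X ω) (X ω)} = ∅ := by
    ext ω; simp; exact he
  rw [this]; simp

lemma goodPath_short {Ω S : Type*} [MeasurableSpace Ω] [MeasurableSpace S] [MetricSpace S]
    [BorelSpace S]
    (P : Measure Ω) [IsProbabilityMeasure P] (hna : Nonatomic P)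
    (β : ℝ → Measure S) (γ : ℝ → Ω → S) (Z : ℝ → Ω → S) (e : ℝ) (he : 0 < e) (a b : ℝ)
    (hab : a < b)
    (hβ : ∀ s ∈ Icc a b, β s = ENNReal.ofReal ((b - s) / (b - a)) • β a
      + ENNReal.ofReal ((s - a) / (b - a)) • β b)
    (hZam : Measurable (Z a)) (hZbm : Measurable (Z b))
    (hZa : (range (Z a)).Finite) (hZb : (range (Z b)).Finite)
    (hZal : P.map (Z a) = β a) (hZbl : P.map (Z b) = β b)
    (hda : ∀ t ∈ Icc a b, P {ω | e ≤ dist (γ t ω) (Z a ω)} ≤ ENNReal.ofReal (e / 2))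
    (hdb : ∀ t ∈ Icc a b, P {ω | e ≤ dist (γ t ω) (Z b ω)} ≤ ENNReal.ofReal (e / 2)) :
    GoodPath P β γ Z e a b := by
  classical
  have hba : 0 < b - a := sub_pos.mpr hab
  obtain ⟨A, hA0, hA1, hAm, hAmono, hAP⟩ := indep_family P hna (fun ω => (Z a ω, Z b ω))
    ((hZa.prod hZb).subset (by rintro _ ⟨ω, rfl⟩; exact ⟨⟨ω, rfl⟩, ⟨ω, rfl⟩⟩))
    (by
      rintro ⟨p, q⟩
      have : (fun ω => (Z a ω, Z b ω)) ⁻¹' {(p, q)} = Z a ⁻¹' {p} ∩ Z b ⁻¹' {q} := by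
        ext ω; simp
      rw [this]
      exact (hZam (measurableSet_singleton p)).inter (hZbm (measurableSet_singleton q)))
  let u : ℝ → ℝ := fun t => (t - a) / (b - a)
  have hu : ∀ t ∈ Icc a b, u t ∈ Icc (0:ℝ) 1 := fun t ht =>
    ⟨div_nonneg (sub_nonneg.mpr ht.1) hba.le,
      (div_le_one hba).mpr (sub_le_sub_right ht.2 a)⟩
  have hAPa : ∀ v ∈ Icc (0:ℝ) 1, ∀ V : Set S, P (Z a ⁻¹' V ∩ A v) =
      ENNReal.ofReal v * P (Z a ⁻¹' V) := fun v hv V => hAP v hv (Prod.fst ⁻¹' V)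
  have hAPb : ∀ v ∈ Icc (0:ℝ) 1, ∀ V : Set S, P (Z b ⁻¹' V ∩ A v) =
      ENNReal.ofReal v * P (Z b ⁻¹' V) := fun v hv V => hAP v hv (Prod.snd ⁻¹' V)
  have hAu : ∀ v ∈ Icc (0:ℝ) 1, P (A v) = ENNReal.ofReal v := by
    intro v hv
    simpa using hAPa v hv univ
  have hAdiff : ∀ v ∈ Icc (0:ℝ) 1, ∀ v' ∈ Icc (0:ℝ) 1, v ≤ v' →
      P (A v' \ A v) = ENNReal.ofReal (v' - v) := by
    intro v hv v' hv' h
    rw [measure_sdiff (hAmono v hv v' hv' h) (hAm v hv).nullMeasurableSet (measure_ne_top _ _),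
      hAu v hv, hAu v' hv', ENNReal.ofReal_sub _ hv.1]
  have hAc : ∀ v ∈ Icc (0:ℝ) 1, ∀ V : Set S,
      P (Z a ⁻¹' V \ A v) = ENNReal.ofReal (1 - v) * P (Z a ⁻¹' V) := by
    intro v hv V
    have h1 := measure_inter_add_sdiff (μ := P) (Z a ⁻¹' V) (hAm v hv)
    rw [hAPa v hv V] at h1
    have h2 : ENNReal.ofReal v * P (Z a ⁻¹' V) + ENNReal.ofReal (1 - v) * P (Z a ⁻¹' V) =
        P (Z a ⁻¹' V) := by
      rw [← add_mul, ← ENNReal.ofReal_add hv.1 (sub_nonneg.mpr hv.2)]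
      simp
    exact (ENNReal.add_right_inj
      (ENNReal.mul_ne_top ENNReal.ofReal_ne_top (measure_ne_top _ _))).mp (h1.trans h2.symm)
  let y : ℝ → Ω → S := fun t ω => if ω ∈ A (u t) then Z b ω else Z a ω
  have hym : ∀ t ∈ Icc a b, Measurable (y t) := fun t ht =>
    Measurable.ite (hAm _ (hu t ht)) hZbm hZam
  have hcont : ∀ s ∈ Icc a b, ∀ t ∈ Icc a b, s ≤ t → ∀ e' > 0,
      P {ω | e' ≤ dist (y s ω) (y t ω)} ≤ ENNReal.ofReal ((t - s) / (b - a)) := by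
    intro s hs t ht hst e' he'
    have hust : u s ≤ u t := by
      simp only [u]; gcongr
    have h1 : {ω | e' ≤ dist (y s ω) (y t ω)} ⊆ A (u t) \ A (u s) := by
      intro ω hω
      rw [Set.mem_ofPred_eq] at hω
      have hsub := hAmono _ (hu s hs) _ (hu t ht) hust
      by_cases h2 : ω ∈ A (u s)
      · have h3 := hsub h2
        simp [y, h2, h3] at hω
        linarith
      · by_cases h3 : ω ∈ A (u t)
        · exact ⟨h3, h2⟩
        · simp [y, h2, h3] at hω
          linarith
    refine (measure_mono h1).trans ?_
    rw [hAdiff _ (hu s hs) _ (hu t ht) hust]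
    apply le_of_eq
    congr 1
    simp only [u]
    field_simp
    ring
  refine ⟨y, ?_, ?_, hym, ?_, ?_, ?_⟩
  · ext ω; simp [y, u, hA0]
  · ext ω; simp [y, u, div_self hba.ne', hA1]
  · intro t ht ε hε
    refine ⟨ε / 2 * (b - a), by positivity, fun s hs hst => ?_⟩
    refine lt_of_le_of_lt (kyFan_le P _ _ (ε / 2) (by positivity) ?_) (half_lt_self hε)
    have hst' : |s - t| / (b - a) ≤ ε / 2 := (div_le_iff₀ hba).mpr hst.le
    rcases le_total s t with h | h
    · refine (hcont s hs t ht h _ (by positivity)).trans (ENNReal.ofReal_le_ofReal ?_)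
      rwa [abs_sub_comm, abs_of_nonneg (sub_nonneg.mpr h)] at hst'
    · have := hcont t ht s hs h (ε / 2) (by positivity)
      simp only [dist_comm (y t _) (y s _)] at this
      refine this.trans (ENNReal.ofReal_le_ofReal ?_)
      rwa [abs_of_nonneg (sub_nonneg.mpr h)] at hst'
  · intro t ht
    rw [hβ t ht]
    ext V hV
    rw [Measure.map_apply (hym t ht) hV]
    have h1 : y t ⁻¹' V = (Z a ⁻¹' V \ A (u t)) ∪ (Z b ⁻¹' V ∩ A (u t)) := by
      ext ω
      by_cases h : ω ∈ A (u t) <;> simp [y, h]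
    rw [h1, measure_union _ ((hZbm hV).inter (hAm _ (hu t ht))), hAc _ (hu t ht),
      hAPb _ (hu t ht)]
    · rw [← hZal, ← hZbl]
      simp only [Measure.add_apply, Measure.smul_apply, smul_eq_mul,
        Measure.map_apply hZam hV, Measure.map_apply hZbm hV]
      congr 3
      simp only [u]
      field_simp
      ring
    · exact disjoint_sdiff_left.mono_right inter_subset_right
  · intro t ht
    refine kyFan_le P _ _ e he ?_
    have h1 : {ω | e ≤ dist (γ t ω) (y t ω)} ⊆
        {ω | e ≤ dist (γ t ω) (Z a ω)} ∪ {ω | e ≤ dist (γ t ω) (Z b ω)} := by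
      intro ω hω
      rw [Set.mem_ofPred_eq] at hω
      by_cases h : ω ∈ A (u t)
      · right; simpa [y, h] using hω
      · left; simpa [y, h] using hω
    calc _ ≤ _ := measure_mono h1
      _ ≤ _ := measure_union_le _ _
      _ ≤ ENNReal.ofReal (e / 2) + ENNReal.ofReal (e / 2) := add_le_add (hda t ht) (hdb t ht)
      _ = _ := by rw [← ENNReal.ofReal_add (by positivity) (by positivity), add_halves]

lemma goodPath_refl {Ω S : Type*} [MeasurableSpace Ω] [MeasurableSpace S] [MetricSpace S]
    (P : Measure Ω) (β : ℝ → Measure S) (γ : ℝ → Ω → S) (Z : ℝ → Ω → S) (e : ℝ) (a : ℝ)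
    (hm : Measurable (Z a)) (hl : P.map (Z a) = β a) (hd : kyFanDist P (γ a) (Z a) ≤ e) :
    GoodPath P β γ Z e a a := by
  refine ⟨fun _ => Z a, rfl, rfl, fun _ _ => hm, ?_, ?_, ?_⟩
  · intro t ht ε hε
    exact ⟨1, one_pos, fun s _ _ => kyFan_self P _ ε hε⟩
  · intro t ht
    rw [Icc_self, mem_singleton_iff] at ht
    rw [ht, hl]
  · intro t ht
    rw [Icc_self, mem_singleton_iff] at ht
    rw [ht]; exact hd

lemma finSupp_combo {S : Type*} [MeasurableSpace S] {μ ν : Measure S}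
    (hμ : FinitelySupported μ) (hν : FinitelySupported ν) (x y : ℝ≥0∞) (hxy : x + y = 1) :
    FinitelySupported (x • μ + y • ν) := by
  obtain ⟨n, c, a, hc, rfl⟩ := hμ
  obtain ⟨m, d, b, hd, rfl⟩ := hν
  refine ⟨n + m, Fin.append (fun i => x * c i) (fun i => y * d i), Fin.append a b, ?_, ?_⟩
  · rw [Fin.sum_univ_add]
    simp only [Fin.append_left, Fin.append_right, ← Finset.mul_sum, hc, hd, mul_one, hxy]
  · rw [Fin.sum_univ_add]
    simp only [Fin.append_left, Fin.append_right, Finset.smul_sum, smul_smul]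

lemma affine_sub {S : Type*} [MeasurableSpace S] (β : ℝ → Measure S) (μ ν : Measure S)
    (t0 t1 : ℝ) (h01 : t0 < t1)
    (hβ : ∀ s ∈ Icc t0 t1, β s = ENNReal.ofReal ((t1 - s) / (t1 - t0)) • μ
      + ENNReal.ofReal ((s - t0) / (t1 - t0)) • ν) (a b : ℝ) (hab : a < b) (ha : t0 ≤ a)
    (hb : b ≤ t1) :
    ∀ s ∈ Icc a b, β s = ENNReal.ofReal ((b - s) / (b - a)) • β a
      + ENNReal.ofReal ((s - a) / (b - a)) • β b := by
  intro s hs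
  have h1 : 0 < t1 - t0 := sub_pos.mpr h01
  have h2 : 0 < b - a := sub_pos.mpr hab
  have h3 : 0 ≤ (b - s) / (b - a) := div_nonneg (sub_nonneg.mpr hs.2) h2.le
  have h4 : 0 ≤ (s - a) / (b - a) := div_nonneg (sub_nonneg.mpr hs.1) h2.le
  have hnn1 : ∀ z, z ≤ t1 → 0 ≤ (t1 - z) / (t1 - t0) := fun z hz =>
    div_nonneg (sub_nonneg.mpr hz) h1.le
  have hnn0 : ∀ z, t0 ≤ z → 0 ≤ (z - t0) / (t1 - t0) := fun z hz =>
    div_nonneg (sub_nonneg.mpr hz) h1.le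
  have ha1 := hnn1 a (hab.le.trans hb)
  have ha0 := hnn0 a ha
  have hb1 := hnn1 b hb
  have hb0 := hnn0 b (ha.trans hab.le)
  rw [hβ s ⟨ha.trans hs.1, hs.2.trans hb⟩, hβ a ⟨ha, hab.le.trans hb⟩,
    hβ b ⟨ha.trans hab.le, hb⟩]
  simp only [smul_add, smul_smul]
  rw [add_add_add_comm, ← add_smul, ← add_smul, ← ENNReal.ofReal_mul h3, ← ENNReal.ofReal_mul h3,
    ← ENNReal.ofReal_mul h4, ← ENNReal.ofReal_mul h4,
    ← ENNReal.ofReal_add (mul_nonneg h3 ha1) (mul_nonneg h4 hb1),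
    ← ENNReal.ofReal_add (mul_nonneg h3 ha0) (mul_nonneg h4 hb0)]
  congr 3
  · field_simp
    ring
  · field_simp
    ring

/-- If a polygonal path `β` with finitely supported vertices uniformly `ε`-approximates a
continuous path `α` of probability measures, then any continuous lifting `α̂` of `α` admits
a continuous lifting `β̂` of `β` with `sup_t ρ(α̂ t, β̂ t) ≤ 5ε`. -/
theorem stmt14 {Ω S : Type*} [MeasurableSpace Ω] [MeasurableSpace S] [MetricSpace S]
    [BorelSpace S] [CompleteSpace S] [TopologicalSpace.SeparableSpace S]
    (P : Measure Ω) [IsProbabilityMeasure P] (hna : Nonatomic P)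
    (α : ℝ → Measure S) (hprob : ∀ t ∈ Set.Icc (0 : ℝ) 1, IsProbabilityMeasure (α t))
    (hcont : LPContinuousOn α (Set.Icc 0 1))
    (β : ℝ → Measure S)
    (hβ : IsPolygonalWithVertices β {μ | FinitelySupported μ ∧ IsProbabilityMeasure μ})
    {ε : ℝ} (hε : 0 < ε)
    (happrox : ∀ t ∈ Set.Icc (0 : ℝ) 1, levyProkhorovDist (α t) (β t) < ε)
    (αhat : ℝ → Ω → S)
    (hαmeas : ∀ t ∈ Set.Icc (0 : ℝ) 1, Measurable (αhat t))
    (hαcont : KyFanContinuousOn P αhat (Set.Icc 0 1))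
    (hαlaw : ∀ t ∈ Set.Icc (0 : ℝ) 1, P.map (αhat t) = α t) :
    ∃ βhat : ℝ → Ω → S,
      (∀ t ∈ Set.Icc (0 : ℝ) 1, Measurable (βhat t)) ∧
      KyFanContinuousOn P βhat (Set.Icc 0 1) ∧
      (∀ t ∈ Set.Icc (0 : ℝ) 1, P.map (βhat t) = β t) ∧
      ∀ t ∈ Set.Icc (0 : ℝ) 1, kyFanDist P (αhat t) (βhat t) ≤ 5 * ε := by
  obtain ⟨n, t, μ, htmono, ht0, ht1, hμ, hβt⟩ := hβ
  have hK : ∀ i : Fin (n + 1), ∀ s ∈ Icc (t i.castSucc) (t i.succ), s ∈ Icc (0:ℝ) 1 := by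
    intro i s hs
    constructor
    · rw [← ht0]; exact (htmono.monotone (Fin.zero_le _)).trans hs.1
    · rw [← ht1]; exact hs.2.trans (htmono.monotone (Fin.le_last _))
  have hlt : ∀ i : Fin (n + 1), t i.castSucc < t i.succ := fun i =>
    htmono (Fin.castSucc_lt_succ)
  have hvert : ∀ s, (∃ i : Fin (n + 1), s ∈ Icc (t i.castSucc) (t i.succ)) →
      ∃ Y : Ω → S, Measurable Y ∧ (range Y).Finite ∧ P.map Y = β s ∧
        P {ω | ε ≤ dist (αhat s ω) (Y ω)} ≤ ENNReal.ofReal (ε + ε / 2) := by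
    rintro s ⟨i, hs⟩
    have hs01 := hK i s hs
    have hpos : 0 < t i.succ - t i.castSucc := sub_pos.mpr (hlt i)
    have hfs : FinitelySupported (β s) := by
      rw [hβt i s hs]
      refine finSupp_combo (hμ _).1 (hμ _).1 _ _ ?_
      rw [← ENNReal.ofReal_add (div_nonneg (sub_nonneg.mpr hs.2) hpos.le)
        (div_nonneg (sub_nonneg.mpr hs.1) hpos.le), ← add_div, sub_add_sub_cancel,
        div_self hpos.ne', ENNReal.ofReal_one]
    obtain ⟨m, c, a, hc, hν⟩ := hfs
    refine strassen_finite P hna (αhat s) (hαmeas s hs01) m c a hc (β s) hν ε (ε / 2) hε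
      (by positivity) ?_
    rw [hαlaw s hs01]
    exact happrox s hs01
  have : Nonempty (Ω → S) := ⟨αhat 0⟩
  choose! Z hZm hZf hZl hZd using hvert
  obtain ⟨δ, hδ, hosc⟩ := uniform_osc P αhat hαcont ε hε
  have hclose : ∀ s, (∃ i : Fin (n + 1), s ∈ Icc (t i.castSucc) (t i.succ)) →
      ∀ r ∈ Icc (0:ℝ) 1, |r - s| < δ →
      P {ω | 5 * ε ≤ dist (αhat r ω) (Z s ω)} ≤ ENNReal.ofReal (5 * ε / 2) := by
    intro s hs r hr hrs
    obtain ⟨i, hi⟩ := hs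
    calc P {ω | 5 * ε ≤ dist (αhat r ω) (Z s ω)} ≤ P {ω | ε + ε ≤ dist (αhat r ω) (Z s ω)} := by
          apply measure_mono
          intro ω hω
          rw [Set.mem_ofPred_eq] at hω ⊢
          linarith
      _ ≤ _ := dist_union P (αhat r) (αhat s) (Z s) ε ε
      _ ≤ ENNReal.ofReal ε + ENNReal.ofReal (ε + ε / 2) :=
          add_le_add (hosc r hr s (hK i s hi) hrs) (hZd s ⟨i, hi⟩)
      _ = _ := by
          rw [← ENNReal.ofReal_add (by positivity) (by positivity)]
          congr 1; ring
  have hrefl : ∀ s, (∃ i : Fin (n + 1), s ∈ Icc (t i.castSucc) (t i.succ)) →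
      GoodPath P β αhat Z (5 * ε) s s := by
    intro s hs
    refine goodPath_refl P β αhat Z (5 * ε) s (hZm s hs) (hZl s hs) ?_
    obtain ⟨i, hi⟩ := hs
    refine kyFan_le P _ _ _ (by positivity) ((hclose s ⟨i, hi⟩ s (hK i s hi) (by simpa)).trans ?_)
    apply ENNReal.ofReal_le_ofReal
    linarith
  have hseg : ∀ i : Fin (n + 1), ∀ k : ℕ, ∀ b ∈ Icc (t i.castSucc) (t i.succ),
      b - t i.castSucc ≤ k * (δ / 2) → GoodPath P β αhat Z (5 * ε) (t i.castSucc) b := by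
    intro i k
    induction k with
    | zero =>
      intro b hb h
      have : b = t i.castSucc := le_antisymm (by simpa [sub_nonpos] using h) hb.1
      rw [this]
      exact hrefl _ ⟨i, left_mem_Icc.mpr (hlt i).le⟩
    | succ k ih =>
      intro b hb h
      rcases hb.1.lt_or_eq with hlt' | heq
      swap
      · rw [← heq]
        exact hrefl _ ⟨i, left_mem_Icc.mpr (hlt i).le⟩
      set c := max (t i.castSucc) (b - δ / 2) with hcdef
      have hc1 : t i.castSucc ≤ c := le_max_left _ _
      have hc2 : b - δ / 2 ≤ c := le_max_right _ _
      have hcb : c < b := max_lt hlt' (by linarith)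
      have hcI : c ∈ Icc (t i.castSucc) (t i.succ) := ⟨hc1, hcb.le.trans hb.2⟩
      have h1 : GoodPath P β αhat Z (5 * ε) (t i.castSucc) c := by
        apply ih c hcI
        push_cast at h
        rw [sub_le_iff_le_add]
        apply max_le
        · have : 0 ≤ (k : ℝ) * (δ / 2) := by positivity
          linarith
        · linarith
      refine h1.trans hc1 hcb.le ?_
      refine goodPath_short P hna β αhat Z (5 * ε) (by positivity) c b hcb
        (affine_sub β _ _ _ _ (hlt i) (hβt i) c b hcb hc1 hb.2)
        (hZm c ⟨i, hcI⟩) (hZm b ⟨i, hb⟩) (hZf c ⟨i, hcI⟩) (hZf b ⟨i, hb⟩)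
        (hZl c ⟨i, hcI⟩) (hZl b ⟨i, hb⟩) ?_ ?_
      · intro r hr
        refine hclose c ⟨i, hcI⟩ r (hK i r ⟨hc1.trans hr.1, hr.2.trans hb.2⟩) ?_
        rw [abs_lt]; constructor <;> linarith [hr.1, hr.2]
      · intro r hr
        refine hclose b ⟨i, hb⟩ r (hK i r ⟨hc1.trans hr.1, hr.2.trans hb.2⟩) ?_
        rw [abs_lt]; constructor <;> linarith [hr.1, hr.2]
  have hall : ∀ i : Fin (n + 2), GoodPath P β αhat Z (5 * ε) (t 0) (t i) := by
    intro i
    induction i using Fin.induction with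
    | zero => exact hrefl _ ⟨0, left_mem_Icc.mpr (hlt 0).le⟩
    | succ i ih =>
      refine ih.trans (htmono.monotone (Fin.zero_le _)) (hlt i).le ?_
      obtain ⟨k, hk⟩ := exists_nat_ge ((t i.succ - t i.castSucc) / (δ / 2))
      refine hseg i k _ (right_mem_Icc.mpr (hlt i).le) ?_
      rwa [div_le_iff₀ (by positivity)] at hk
  have hfinal := hall (Fin.last (n + 1))
  rw [ht0, ht1] at hfinal
  obtain ⟨y, -, -, hy1, hy2, hy3, hy4⟩ := hfinal
  exact ⟨y, hy1, hy2, hy3, hy4⟩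
end

section
/- Let α : [0,1] → P(S) be continuous in the weak topology, and let X_μ, X_ν be random variables on a complete nonatomic probability space with law(X_μ) = α(0) and law(X_ν) = α(1). Then there exists a continuous map α̂ : [0,1] → L⁰(Ω,S) (convergence in probability topology) with α̂(0) = X_μ, α̂(1) = X_ν, and law(α̂(t)) = α(t) for all t ∈ [0,1]. -/
open MeasureTheory Filter Topology Set
open scoped ENNReal NNReal

/-- Uniform law on the unit interval, as a measure on the line. -/
noncomputable def nuU : Measure ℝ := volume.restrict (Ioo 0 1)

instance nuU_prob : IsProbabilityMeasure nuU := ⟨by simp [nuU]⟩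

instance nuU_noAtoms : NullSingletonClass nuU := by unfold nuU; infer_instance

lemma nuU_mem : ∀ᵐ u ∂nuU, u ∈ Ioo (0:ℝ) 1 := by
  unfold nuU; exact ae_restrict_mem measurableSet_Ioo

lemma tim_preimage {Ω ι : Type*} [MeasurableSpace Ω] (P : Measure Ω)
    (ν' : Measure ℝ) [IsFiniteMeasure ν'] {l : Filter ι} {φ : ι → Ω → ℝ} {φ0 : Ω → ℝ}
    (hle : ∀ᶠ i in l, ∀ B, MeasurableSet B → P (φ i ⁻¹' B) ≤ ν' B)
    (hle0 : ∀ B, MeasurableSet B → P (φ0 ⁻¹' B) ≤ ν' B)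
    (h : TendstoInMeasure P φ l φ0) (B : Set ℝ) (hB : MeasurableSet B) :
    Tendsto (fun i => P (φ0 ⁻¹' B \ φ i ⁻¹' B)) l (𝓝 0) := by
  rw [ENNReal.tendsto_nhds_zero]
  intro ε hε
  have hε3 : ε / 3 ≠ 0 := by
    simp [ENNReal.div_eq_zero_iff, hε.ne']
  obtain ⟨K, hKB, hK, hKε⟩ := hB.exists_isCompact_sdiff_lt (measure_ne_top ν' B) hε3
  obtain ⟨U, hBU, hU, hUtop, hUε⟩ := hB.exists_isOpen_sdiff_lt (measure_ne_top ν' B) hε3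
  obtain ⟨δ, hδ, hδU⟩ := hK.exists_thickening_subset_open hU (hKB.trans hBU)
  rw [tendstoInMeasure_iff_dist] at h
  have h1 := (ENNReal.tendsto_nhds_zero.1 (h δ hδ)) (ε/3) (pos_iff_ne_zero.2 hε3)
  filter_upwards [h1, hle] with i hi hlei
  have hsub : φ0 ⁻¹' B \ φ i ⁻¹' B ⊆ (φ0 ⁻¹' (B \ K)) ∪ {x | δ ≤ dist (φ i x) (φ0 x)}
      ∪ φ i ⁻¹' (U \ B) := by
    rintro x ⟨hx1, hx2⟩
    by_cases hxK : φ0 x ∈ K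
    · by_cases hd : δ ≤ dist (φ i x) (φ0 x)
      · exact Or.inl (Or.inr hd)
      · refine Or.inr ⟨hδU ?_, hx2⟩
        rw [Metric.mem_thickening_iff]
        exact ⟨_, hxK, not_le.1 hd⟩
    · exact Or.inl (Or.inl ⟨hx1, hxK⟩)
  calc P (φ0 ⁻¹' B \ φ i ⁻¹' B) ≤ _ := measure_mono hsub
    _ ≤ P (φ0 ⁻¹' (B \ K)) + P {x | δ ≤ dist (φ i x) (φ0 x)} + P (φ i ⁻¹' (U \ B)) :=
        (measure_union_le _ _).trans (add_le_add (measure_union_le _ _) le_rfl)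
    _ ≤ ε/3 + ε/3 + ε/3 := by
        gcongr
        · exact (hle0 _ (hB.diff hK.measurableSet)).trans hKε.le
        · exact (hlei _ (hU.measurableSet.diff hB)).trans hUε.le
    _ = ε := ENNReal.add_thirds ε

lemma exists_small_cells {Ω S : Type*} [MeasurableSpace Ω] [MeasurableSpace S]
    (P : Measure Ω) [IsFiniteMeasure P] (x : Ω → S) (hx : Measurable x)
    (A : ℕ → Set S) (hA : ∀ k, MeasurableSet (A k)) (hc : ∀ y, ∃ k, y ∈ A k) :
    Tendsto (fun n : ℕ => P {ω | ∀ k < n, x ω ∉ A k}) atTop (𝓝 0) := by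
  have h := tendsto_measure_iInter_atTop (μ := P) (s := fun n : ℕ => {ω | ∀ k < n, x ω ∉ A k})
    (fun n => by
      apply MeasurableSet.nullMeasurableSet
      have : {ω | ∀ k < n, x ω ∉ A k} = ⋂ k, ⋂ (_ : k < n), x ⁻¹' (A k)ᶜ := by
        ext; simp
      rw [this]
      exact MeasurableSet.iInter fun k => MeasurableSet.iInter fun _ => hx (hA k).compl)
    (fun n m hnm ω hω k hk => hω k (hk.trans_le hnm)) ⟨0, measure_ne_top _ _⟩
  have h2 : (⋂ n : ℕ, {ω | ∀ k < n, x ω ∉ A k}) = ∅ := by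
    ext ω
    simp only [mem_iInter, mem_ofPred_eq, mem_empty_iff_false, iff_false, not_forall]
    obtain ⟨k, hk⟩ := hc (x ω)
    exact ⟨k + 1, k, Nat.lt_succ_self k, fun h => h hk⟩
  rw [h2, measure_empty] at h
  exact h

lemma tim_comp_measurable {Ω ι S : Type*} [MeasurableSpace Ω] (P : Measure Ω) [IsFiniteMeasure P]
    [MetricSpace S] [MeasurableSpace S] [BorelSpace S] [TopologicalSpace.SeparableSpace S]
    (ν' : Measure ℝ) [IsFiniteMeasure ν'] {l : Filter ι} {φ : ι → Ω → ℝ} {φ0 : Ω → ℝ}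
    (hle : ∀ᶠ i in l, ∀ B, MeasurableSet B → P (φ i ⁻¹' B) ≤ ν' B)
    (hφ0 : Measurable φ0)
    (hle0 : ∀ B, MeasurableSet B → P (φ0 ⁻¹' B) ≤ ν' B)
    (h : TendstoInMeasure P φ l φ0) (f : ℝ → S) (hf : Measurable f) :
    TendstoInMeasure P (fun i => f ∘ φ i) l (f ∘ φ0) := by
  rw [tendstoInMeasure_iff_dist]
  intro ε hε
  have : Nonempty S := ⟨f 0⟩
  let A : ℕ → Set S := fun k => Metric.ball (TopologicalSpace.denseSeq S k) (ε/2)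
  have hA : ∀ k, MeasurableSet (A k) := fun k => Metric.isOpen_ball.measurableSet
  have hc : ∀ y, ∃ k, y ∈ A k := by
    intro y
    obtain ⟨k, hk⟩ := (TopologicalSpace.denseRange_denseSeq S).exists_dist_lt y (half_pos hε)
    exact ⟨k, hk⟩
  rw [ENNReal.tendsto_nhds_zero]
  intro η hη
  have hη2 : 0 < η / 2 := ENNReal.half_pos hη.ne'
  obtain ⟨n, hn⟩ := ((ENNReal.tendsto_nhds_zero.1
    (exists_small_cells P (f ∘ φ0) (hf.comp hφ0) A hA hc)) (η/2) hη2).exists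
  have hsum : Tendsto (fun i => ∑ k ∈ Finset.range n,
      P (φ0 ⁻¹' (f ⁻¹' A k) \ φ i ⁻¹' (f ⁻¹' A k))) l (𝓝 0) := by
    rw [← Finset.sum_const_zero (s := Finset.range n)]
    exact tendsto_finsetSum _ fun k _ => tim_preimage P ν' hle hle0 h _ (hf (hA k))
  filter_upwards [(ENNReal.tendsto_nhds_zero.1 hsum) (η/2) hη2] with i hi
  have hsub : {x | ε ≤ dist ((f ∘ φ i) x) ((f ∘ φ0) x)} ⊆ {ω | ∀ k < n, (f ∘ φ0) ω ∉ A k} ∪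
      ⋃ k ∈ Finset.range n, (φ0 ⁻¹' (f ⁻¹' A k) \ φ i ⁻¹' (f ⁻¹' A k)) := by
    intro x hx
    by_cases hx1 : ∀ k < n, (f ∘ φ0) x ∉ A k
    · exact Or.inl hx1
    · push Not at hx1
      obtain ⟨k, hk, hkA⟩ := hx1
      refine Or.inr ?_
      simp only [mem_iUnion, Finset.mem_range]
      refine ⟨k, hk, hkA, fun hk2 => ?_⟩
      have h1 : dist (f (φ0 x)) (TopologicalSpace.denseSeq S k) < ε/2 := hkA
      have h2 : dist (f (φ i x)) (TopologicalSpace.denseSeq S k) < ε/2 := hk2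
      have h3 := dist_triangle_right (f (φ i x)) (f (φ0 x)) (TopologicalSpace.denseSeq S k)
      have : ε ≤ dist (f (φ i x)) (f (φ0 x)) := hx
      linarith
  calc _ ≤ _ := measure_mono hsub
    _ ≤ _ := measure_union_le _ _
    _ ≤ η/2 + η/2 := add_le_add hn ((measure_biUnion_finset_le _ _).trans hi)
    _ = η := ENNReal.add_halves η

lemma tim_triangle {Ω ι S : Type*} [MeasurableSpace Ω] (P : Measure Ω) [PseudoMetricSpace S]
    {l : Filter ι} {f g : ι → Ω → S} {h : Ω → S}
    (h1 : ∀ ε > 0, Tendsto (fun i => P {x | ε ≤ dist (f i x) (g i x)}) l (𝓝 0))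
    (h2 : TendstoInMeasure P g l h) : TendstoInMeasure P f l h := by
  rw [tendstoInMeasure_iff_dist] at *
  intro ε hε
  have := (h1 (ε/2) (half_pos hε)).add (h2 (ε/2) (half_pos hε))
  rw [add_zero] at this
  refine tendsto_of_tendsto_of_tendsto_of_le_of_le tendsto_const_nhds this (fun _ => zero_le) ?_
  intro i
  refine (measure_mono ?_).trans (measure_union_le _ _)
  intro x hx
  by_contra hcon
  simp only [mem_union, mem_ofPred_eq, not_or, not_le] at hcon hx
  have := dist_triangle (f i x) (g i x) (h x)
  linarith

/-- moving part: composing with measure preserving maps. -/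
lemma tim_comp_left {Ω Ω' ι S : Type*} [MeasurableSpace Ω] [MeasurableSpace Ω'] (P : Measure Ω)
    (Q : Measure Ω')
    [MetricSpace S] [MeasurableSpace S] [BorelSpace S] [TopologicalSpace.SeparableSpace S]
    {l : Filter ι} {V : ι → Ω → Ω'} (hV : ∀ᶠ i in l, MeasurePreserving (V i) P Q)
    {A : ι → Ω' → S} {A0 : Ω' → S} (hA : ∀ᶠ i in l, Measurable (A i)) (hA0 : Measurable A0)
    (h : TendstoInMeasure Q A l A0) (ε : ℝ) (hε : 0 < ε) :
    Tendsto (fun i => P {x | ε ≤ dist (A i (V i x)) (A0 (V i x))}) l (𝓝 0) := by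
  rw [tendstoInMeasure_iff_dist] at h
  refine (h ε hε).congr' ?_
  filter_upwards [hV, hA] with i hi hAi
  have hm : MeasurableSet {x | ε ≤ dist (A i x) (A0 x)} :=
    measurableSet_le measurable_const (hAi.dist hA0)
  exact (hi.measure_preimage hm.nullMeasurableSet).symm

lemma tim_comp {Ω ι S : Type*} [MeasurableSpace Ω] (P : Measure Ω) [IsFiniteMeasure P]
    (Q : Measure ℝ) [IsFiniteMeasure Q]
    [MetricSpace S] [MeasurableSpace S] [BorelSpace S] [TopologicalSpace.SeparableSpace S]
    {l : Filter ι} {V : ι → Ω → ℝ} (hV : ∀ᶠ i in l, MeasurePreserving (V i) P Q)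
    {V0 : Ω → ℝ} (hV0 : MeasurePreserving V0 P Q) (hVV : TendstoInMeasure P V l V0)
    {A : ι → ℝ → S} {A0 : ℝ → S} (hA : ∀ᶠ i in l, Measurable (A i)) (hA0 : Measurable A0)
    (h : TendstoInMeasure Q A l A0) :
    TendstoInMeasure P (fun i => A i ∘ V i) l (A0 ∘ V0) := by
  refine tim_triangle P (g := fun i => A0 ∘ V i) (tim_comp_left P Q hV hA hA0 h) ?_
  refine tim_comp_measurable P Q ?_ hV0.measurable ?_ hVV A0 hA0
  · filter_upwards [hV] with i hi B hB
    rw [hi.measure_preimage hB.nullMeasurableSet]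
  · intro B hB
    rw [hV0.measure_preimage hB.nullMeasurableSet]

/-- The quantile function of a probability measure on the line. -/
noncomputable def qt (ρ : Measure ℝ) (u : ℝ) : ℝ :=
  open Classical in if u ∈ Ioo (0:ℝ) 1 then sInf {x | u ≤ ProbabilityTheory.cdf ρ x} else 0

lemma qt_le_iff (ρ : Measure ℝ) {u : ℝ} (hu : u ∈ Ioo (0:ℝ) 1) (x : ℝ) :
    qt ρ u ≤ x ↔ u ≤ ProbabilityTheory.cdf ρ x := by
  rw [qt, if_pos hu]
  set F := ProbabilityTheory.cdf ρ with hF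
  have hmono : Monotone F := F.mono
  have hne : {x | u ≤ F x}.Nonempty := by
    obtain ⟨y, hy⟩ := ((ProbabilityTheory.tendsto_cdf_atTop ρ).eventually (lt_mem_nhds hu.2)).exists
    exact ⟨y, hy.le⟩
  have hbdd : BddBelow {x | u ≤ F x} := by
    obtain ⟨y, hy⟩ := ((ProbabilityTheory.tendsto_cdf_atBot ρ).eventually (gt_mem_nhds hu.1)).exists
    refine ⟨y, fun z hz => ?_⟩
    by_contra hzy
    exact absurd (hmono (not_le.1 hzy).le) (not_le.2 (lt_of_lt_of_le hy hz))
  constructor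
  · intro h
    have hgt : ∀ y, x < y → u ≤ F y := by
      intro y hy
      obtain ⟨z, hz, hzy⟩ := exists_lt_of_csInf_lt hne (lt_of_le_of_lt h hy)
      exact le_trans hz (hmono hzy.le)
    have hr : Tendsto F (𝓝[>] x) (𝓝 (F x)) :=
      (F.right_continuous x).mono_left (nhdsWithin_mono _ Ioi_subset_Ici_self)
    refine ge_of_tendsto hr ?_
    filter_upwards [self_mem_nhdsWithin] with y hy using hgt y hy
  · intro h
    exact csInf_le hbdd h

lemma measurable_qt {R : Type*} [MeasurableSpace R] (ρ : R → Measure ℝ)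
    (h : ∀ x, Measurable fun r => ProbabilityTheory.cdf (ρ r) x) :
    Measurable (fun p : R × ℝ => qt (ρ p.1) p.2) := by
  refine measurable_of_Iic fun x => ?_
  have : (fun p : R × ℝ => qt (ρ p.1) p.2) ⁻¹' Iic x =
      ({p | p.2 ∈ Ioo (0:ℝ) 1} ∩ {p | p.2 ≤ ProbabilityTheory.cdf (ρ p.1) x}) ∪
      ({p | p.2 ∈ Ioo (0:ℝ) 1}ᶜ ∩ {p : R × ℝ | (0:ℝ) ≤ x}) := by
    ext p
    by_cases hp : p.2 ∈ Ioo (0:ℝ) 1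
    · simp only [mem_preimage, mem_Iic, qt_le_iff (ρ p.1) hp]
      simp only [mem_union, mem_inter_iff, mem_compl_iff, mem_ofPred_eq, hp, true_and,
        not_true, false_and, or_false]
    · have : qt (ρ p.1) p.2 = 0 := by rw [qt, if_neg hp]
      simp only [mem_preimage, mem_Iic, this]
      simp only [mem_union, mem_inter_iff, mem_compl_iff, mem_ofPred_eq, hp, true_and,
        not_false_eq_true, false_and, false_or]
  rw [this]
  have h1 : MeasurableSet {p : R × ℝ | p.2 ∈ Ioo (0:ℝ) 1} := measurable_snd measurableSet_Ioo
  refine (h1.inter ?_).union (h1.compl.inter ?_)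
  · exact measurableSet_le measurable_snd ((h x).comp measurable_fst)
  · exact MeasurableSet.const _

lemma measurable_qt' (ρ : Measure ℝ) : Measurable (qt ρ) :=
  (measurable_qt (R := Unit) (fun _ => ρ) (fun _ => measurable_const)).comp
    (measurable_const.prodMk measurable_id (f := fun _ : ℝ => ()))

lemma map_qt (ρ : Measure ℝ) [IsProbabilityMeasure ρ] : nuU.map (qt ρ) = ρ := by
  have : IsProbabilityMeasure (nuU.map (qt ρ)) :=
    Measure.isProbabilityMeasure_map (measurable_qt' ρ).aemeasurable
  refine Measure.ext_of_Iic _ _ fun x => ?_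
  rw [Measure.map_apply (measurable_qt' ρ) measurableSet_Iic, ← ProbabilityTheory.ofReal_cdf ρ x]
  set c := ProbabilityTheory.cdf ρ x
  have hc0 : 0 ≤ c := ProbabilityTheory.cdf_nonneg ρ x
  have hc1 : c ≤ 1 := ProbabilityTheory.cdf_le_one ρ x
  have : nuU (qt ρ ⁻¹' Iic x) = nuU (Iic c) := by
    apply measure_congr
    filter_upwards [nuU_mem] with u hu
    exact propext (qt_le_iff ρ hu x)
  rw [this, nuU, Measure.restrict_apply measurableSet_Iic]
  have h2 : volume (Iic c ∩ Ioo 0 1) = volume (Ioc 0 c) := by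
    have : (Ioc 0 c : Set ℝ) =ᵐ[volume] Ioo 0 c := Ioo_ae_eq_Ioc.symm
    apply le_antisymm
    · exact measure_mono fun y hy => ⟨hy.2.1, hy.1⟩
    · rw [measure_congr this]
      exact measure_mono fun y hy => ⟨hy.2.le, hy.1, hy.2.trans_le hc1⟩
  rw [h2]; simp

lemma cdf_qt (ρ : Measure ℝ) [IsProbabilityMeasure ρ] [NullSingletonClass ρ] {u : ℝ}
    (hu : u ∈ Ioo (0:ℝ) 1) : ProbabilityTheory.cdf ρ (qt ρ u) = u := by
  apply le_antisymm
  · set F := ProbabilityTheory.cdf ρ with hF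
    set a := qt ρ u
    have h1 := F.measure_singleton a
    rw [hF, ProbabilityTheory.measure_cdf, measure_singleton, ← hF] at h1
    have h2 : F a ≤ Function.leftLim F a := by
      have := ENNReal.ofReal_eq_zero.1 h1.symm
      linarith
    refine h2.trans ?_
    refine le_of_tendsto (F.mono.tendsto_leftLim a) ?_
    filter_upwards [self_mem_nhdsWithin] with y hy
    by_contra hcon
    exact absurd ((qt_le_iff ρ hu y).2 (not_le.1 hcon).le) (not_le.2 hy)
  · exact (qt_le_iff ρ hu _).1 le_rfl

lemma exists_iso_real (ρ : Measure ℝ) [IsProbabilityMeasure ρ] [NullSingletonClass ρ] :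
    MeasurePreserving (ProbabilityTheory.cdf ρ) ρ nuU ∧ MeasurePreserving (qt ρ) nuU ρ ∧
    (∀ᵐ z ∂ρ, qt ρ (ProbabilityTheory.cdf ρ z) = z) ∧
    (∀ᵐ u ∂nuU, ProbabilityTheory.cdf ρ (qt ρ u) = u) := by
  have hF : Measurable (ProbabilityTheory.cdf ρ) := (ProbabilityTheory.cdf ρ).mono.measurable
  have hq := measurable_qt' ρ
  have h4 : ∀ᵐ u ∂nuU, ProbabilityTheory.cdf ρ (qt ρ u) = u := by
    filter_upwards [nuU_mem] with u hu using cdf_qt ρ hu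
  refine ⟨⟨hF, ?_⟩, ⟨hq, map_qt ρ⟩, ?_, h4⟩
  · conv_lhs => rw [← map_qt ρ]
    rw [map_qt ρ]
    conv_lhs => arg 2; rw [← map_qt ρ]
    rw [Measure.map_map hF hq]
    conv_rhs => rw [← Measure.map_id (μ := nuU)]
    exact Measure.map_congr h4
  · have : ∀ᵐ z ∂(nuU.map (qt ρ)), qt ρ (ProbabilityTheory.cdf ρ z) = z := by
      refine (ae_map_iff hq.aemeasurable
        (measurableSet_eq_fun (hq.comp hF) measurable_id)).2 ?_
      filter_upwards [h4] with u hu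
      simp only [Function.comp, hu, id]
    rwa [map_qt ρ] at this

lemma exists_iso {Z : Type*} [MeasurableSpace Z] [StandardBorelSpace Z] (ρ : Measure Z)
    [IsProbabilityMeasure ρ] [NullSingletonClass ρ] :
    ∃ (h : Z → ℝ) (q : ℝ → Z), MeasurePreserving h ρ nuU ∧ MeasurePreserving q nuU ρ ∧
      (∀ᵐ z ∂ρ, q (h z) = z) ∧ (∀ᵐ u ∂nuU, h (q u) = u) := by
  have hZ : Nonempty Z := nonempty_of_isProbabilityMeasure ρ
  let e := embeddingReal Z
  have he : MeasurableEmbedding e := measurableEmbedding_embeddingReal Z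
  obtain ⟨g, hg, hge⟩ := he.exists_measurable_extend measurable_id (fun _ => hZ)
  let ρ' := ρ.map e
  have : IsProbabilityMeasure ρ' := Measure.isProbabilityMeasure_map he.measurable.aemeasurable
  have : NullSingletonClass ρ' := by
    constructor
    intro x
    rw [he.map_apply]
    refine Set.Subsingleton.measure_zero ?_ ρ
    intro a ha b hb
    exact he.injective (ha.trans hb.symm)
  obtain ⟨h1, h2, h3, h4⟩ := exists_iso_real ρ'
  have hemp : MeasurePreserving e ρ ρ' := ⟨he.measurable, rfl⟩
  have hge' : ∀ z, g (e z) = z := fun z => congrFun hge z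
  have hgmp : MeasurePreserving g ρ' ρ := by
    refine ⟨hg, ?_⟩
    rw [Measure.map_map hg he.measurable, hge, Measure.map_id]
  refine ⟨_, _, h1.comp hemp, hgmp.comp h2, ?_, ?_⟩
  · filter_upwards [hemp.quasiMeasurePreserving.ae h3] with z hz
    simp only [Function.comp, hz, hge']
  · have h5 : ∀ᵐ x ∂ρ', e (g x) = x := by
      refine (ae_map_iff he.measurable.aemeasurable
        (measurableSet_eq_fun (he.measurable.comp hg) measurable_id)).2 ?_
      exact ae_of_all _ fun z => by simp only [Function.comp, hge', id]
    filter_upwards [h4, h2.quasiMeasurePreserving.ae h5] with u hu hu2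
    simp only [Function.comp, hu2, hu]

lemma scale_nuU {t : ℝ} (ht : 0 < t) :
    ENNReal.ofReal t • nuU.map (fun u => t * u) = volume.restrict (Ioo 0 t) := by
  have h1 := Real.smul_map_volume_mul_left ht.ne'
  rw [abs_of_pos ht] at h1
  have hm : Measurable (fun u : ℝ => t * u) := measurable_const_mul t
  have h2 : (fun u : ℝ => t * u) ⁻¹' (Ioo 0 t) = Ioo 0 1 := by
    ext u
    simp only [mem_preimage, mem_Ioo]
    constructor
    · rintro ⟨a, b⟩
      exact ⟨by by_contra h; nlinarith, by by_contra h; nlinarith⟩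
    · rintro ⟨a, b⟩
      exact ⟨by positivity, by nlinarith⟩
  conv_rhs => rw [← h1]
  rw [Measure.restrict_smul, Measure.restrict_map hm measurableSet_Ioo, h2, nuU]

/-- Dilated version of `w`, acting on `[0,t]`. -/
noncomputable def dil (w : ℝ → ℝ) (t u : ℝ) : ℝ :=
  open Classical in if u ≤ t then t * w (u / t) else u

lemma measurable_dil {w : ℝ → ℝ} (hw : Measurable w) (t : ℝ) : Measurable (dil w t) := by
  unfold dil
  exact Measurable.ite measurableSet_Iic (by fun_prop) measurable_id

lemma dil_mp {w : ℝ → ℝ} (hw : MeasurePreserving w nuU nuU) {t : ℝ} (ht : t ∈ Icc (0:ℝ) 1) :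
    MeasurePreserving (dil w t) nuU nuU := by
  have hm := measurable_dil hw.measurable t
  refine ⟨hm, ?_⟩
  rcases ht.1.eq_or_lt with h0 | h0
  · conv_rhs => rw [← Measure.map_id (μ := nuU)]
    apply Measure.map_congr
    filter_upwards [nuU_mem] with u hu
    rw [dil, if_neg (by rw [← h0]; exact not_le.2 hu.1)]; rfl
  have hdec : nuU = volume.restrict (Ioo 0 t) + volume.restrict (Ioo t 1) := by
    rw [← Measure.restrict_union (by
      rw [Set.disjoint_left]; intro x hx hx2; exact absurd hx.2 (not_lt.2 hx2.1.le))
      measurableSet_Ioo, nuU]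
    apply Measure.restrict_congr_set
    have : ∀ᵐ x : ℝ, x ≠ t := by
      simp [ae_iff]
    filter_upwards [this] with x hx
    refine propext ⟨fun h => ?_, fun h => ?_⟩
    · rcases lt_or_gt_of_ne hx with h2 | h2
      · exact Or.inl ⟨h.1, h2⟩
      · exact Or.inr ⟨h2, h.2⟩
    · rcases h with h | h
      · exact ⟨h.1, h.2.trans_le ht.2⟩
      · exact ⟨h0.trans h.1, h.2⟩
  have h1 : (volume.restrict (Ioo 0 t)).map (dil w t) = volume.restrict (Ioo 0 t) := by
    rw [← scale_nuU h0, Measure.map_smul, Measure.map_map hm (measurable_const_mul t)]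
    congr 1
    conv_rhs => rw [← hw.map_eq, Measure.map_map (measurable_const_mul t) hw.measurable]
    apply Measure.map_congr
    filter_upwards [nuU_mem] with u hu
    simp only [Function.comp, dil]
    rw [if_pos (by nlinarith [hu.2]), mul_div_cancel_left₀ _ h0.ne']
  have h2 : (volume.restrict (Ioo t 1)).map (dil w t) = volume.restrict (Ioo t 1) := by
    conv_rhs => rw [← Measure.map_id (μ := volume.restrict (Ioo t 1))]
    apply Measure.map_congr
    filter_upwards [ae_restrict_mem measurableSet_Ioo] with u hu
    rw [dil, if_neg (not_le.2 hu.1)]; rfl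
  conv_lhs => rw [hdec]
  rw [Measure.map_add _ _ hm, h1, h2, ← hdec]

lemma dil_cont {w : ℝ → ℝ} (hw : Measurable w) (hb : ∀ u, |w u| ≤ 1)
    {t : ℝ} (ht : t ∈ Icc (0:ℝ) 1) :
    TendstoInMeasure nuU (dil w) (𝓝[Icc 0 1] t) (dil w t) := by
  -- the inner part
  have hin : ∀ ε > 0, Tendsto (fun s => nuU {u | ε ≤ dist (w (u / s)) (w (u / t)) ∧ 0 < t})
      (𝓝[Icc 0 1] t) (𝓝 0) := by
    intro ε hε
    rcases ht.1.eq_or_lt with h0 | h0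
    · simp [← h0]
    have hst : ∀ᶠ s in 𝓝[Icc 0 1] t, t / 2 < s ∧ s ≤ 1 := by
      have : ∀ᶠ s in 𝓝[Icc 0 1] t, t / 2 < s :=
        mem_nhdsWithin_of_mem_nhds (lt_mem_nhds (by linarith))
      filter_upwards [this, self_mem_nhdsWithin] with s h1 h2 using ⟨h1, h2.2⟩
    have hbound : ∀ s, t / 2 < s ∧ s ≤ 1 → ∀ B, MeasurableSet B →
        nuU ((fun u => u / s) ⁻¹' B) ≤ (volume.restrict (Ioo 0 (2 / t))) B := by
      intro s hs B hB
      have hs0 : 0 < s := lt_trans (by positivity) hs.1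
      have hms : MeasurableSet ((fun u : ℝ => u / s) ⁻¹' B) :=
        (measurable_id.div_const s) hB
      rw [nuU, Measure.restrict_apply hms,
        Measure.restrict_apply hB]
      have h1 : (fun u => u / s) ⁻¹' B ∩ Ioo 0 1 ⊆
          (fun u => u * s⁻¹) ⁻¹' (B ∩ Ioo 0 (2 / t)) := by
        rintro u ⟨hu, hu0, hu1⟩
        refine ⟨by simpa [div_eq_mul_inv] using hu, by positivity, ?_⟩
        change u * s⁻¹ < 2 / t
        rw [← div_eq_mul_inv, div_lt_div_iff₀ hs0 h0]
        nlinarith [hs.1]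
      refine (measure_mono h1).trans ?_
      rw [Real.volume_preimage_mul_right (inv_ne_zero hs0.ne'), inv_inv, abs_of_pos hs0]
      calc _ ≤ 1 * volume (B ∩ Ioo 0 (2 / t)) := by
            gcongr
            exact ENNReal.ofReal_le_one.2 hs.2
        _ = _ := one_mul _
    have hfin : IsFiniteMeasure (volume.restrict (Ioo 0 (2 / t))) :=
      ⟨by simp⟩
    have htim : TendstoInMeasure nuU (fun (s : ℝ) (u : ℝ) => u / s) (𝓝[Icc 0 1] t)
        (fun u => u / t) := by
      rw [tendstoInMeasure_iff_dist]
      intro δ hδ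
      apply tendsto_const_nhds.congr'
      have hc : Tendsto (fun s : ℝ => s⁻¹) (𝓝[Icc 0 1] t) (𝓝 t⁻¹) :=
        (tendsto_inv₀ h0.ne').mono_left nhdsWithin_le_nhds
      have := (Metric.tendsto_nhds.1 hc) δ hδ
      filter_upwards [this] with s hs
      symm
      rw [measure_eq_zero_iff_ae_notMem]
      filter_upwards [nuU_mem] with u hu hcon
      change δ ≤ dist (u / s) (u / t) at hcon
      rw [Real.dist_eq] at hs hcon
      rw [div_eq_mul_inv, div_eq_mul_inv, ← mul_sub, abs_mul, abs_of_pos hu.1] at hcon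
      nlinarith [hu.2, hu.1, abs_nonneg (s⁻¹ - t⁻¹)]
    have := tim_comp_measurable nuU (volume.restrict (Ioo 0 (2 / t)))
      (hst.mono hbound) (measurable_id.div_const t)
      (hbound t ⟨by linarith, ht.2⟩) htim w hw
    rw [tendstoInMeasure_iff_dist] at this
    refine (this ε hε).congr fun s => ?_
    simp [h0, Function.comp]
  rw [tendstoInMeasure_iff_dist]
  intro ε hε
  have hvol : Tendsto (fun s : ℝ => ENNReal.ofReal (2 * |s - t|)) (𝓝[Icc 0 1] t) (𝓝 0) := by
    have : Tendsto (fun s : ℝ => ENNReal.ofReal (2 * |s - t|)) (𝓝 t)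
        (𝓝 (ENNReal.ofReal (2 * |t - t|))) := by
      apply ENNReal.continuous_ofReal.continuousAt.tendsto.comp
      apply Continuous.tendsto
      fun_prop
    simp only [sub_self, abs_zero, mul_zero, ENNReal.ofReal_zero] at this
    exact this.mono_left nhdsWithin_le_nhds
  have hlim := hvol.add (hin (ε/2) (half_pos hε))
  rw [add_zero] at hlim
  refine tendsto_of_tendsto_of_tendsto_of_le_of_le' tendsto_const_nhds hlim
    (Eventually.of_forall fun _ => zero_le) ?_
  have hclose : ∀ᶠ s in 𝓝[Icc 0 1] t, |s - t| < ε / 2 := by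
    apply mem_nhdsWithin_of_mem_nhds
    exact Metric.ball_mem_nhds t (half_pos hε)
  filter_upwards [hclose, self_mem_nhdsWithin] with s hs hs01
  have hsub : ({u | ε ≤ dist (dil w s u) (dil w t u)} : Set ℝ) ≤ᵐ[nuU]
      (Icc (t - |s - t|) (t + |s - t|) ∪ {u | ε / 2 ≤ dist (w (u / s)) (w (u / t)) ∧ 0 < t}
        : Set ℝ) := by
    filter_upwards [nuU_mem] with u hu hcon
    change ε ≤ dist (dil w s u) (dil w t u) at hcon
    have ha1 := le_abs_self (s - t)
    have ha2 := neg_abs_le (s - t)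
    by_cases hI : u ∈ Icc (t - |s - t|) (t + |s - t|)
    · exact Or.inl hI
    right
    rcases not_and_or.1 hI with h | h
    · have h1 : u ≤ s := by linarith
      have h2 : u ≤ t := by linarith [abs_nonneg (s - t)]
      have h0 : 0 < t := lt_of_lt_of_le hu.1 h2
      refine ⟨?_, h0⟩
      rw [dil, dil, if_pos h1, if_pos h2, Real.dist_eq] at hcon
      rw [Real.dist_eq]
      have e : s * w (u / s) - t * w (u / t) =
          (s - t) * w (u / s) + t * (w (u / s) - w (u / t)) := by ring
      rw [e] at hcon
      have := abs_add_le ((s - t) * w (u / s)) (t * (w (u / s) - w (u / t)))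
      rw [abs_mul, abs_mul, abs_of_pos h0] at this
      nlinarith [hb (u / s), abs_nonneg (s - t), abs_nonneg (w (u / s) - w (u / t)), ht.2]
    · have h1 : ¬ u ≤ s := by linarith
      have h2 : ¬ u ≤ t := by linarith [abs_nonneg (s - t)]
      rw [dil, dil, if_neg h1, if_neg h2, dist_self] at hcon
      linarith
  refine (measure_mono_ae hsub).trans ((measure_union_le _ _).trans ?_)
  gcongr
  refine (Measure.restrict_apply_le _ _).trans ?_
  rw [Real.volume_Icc]
  apply ENNReal.ofReal_le_ofReal
  linarith

lemma exists_dil_path {w : ℝ → ℝ} (hw : MeasurePreserving w nuU nuU) :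
    ∃ D : ℝ → ℝ → ℝ, (∀ t, MeasurePreserving (D t) nuU nuU) ∧ (∀ᵐ u ∂nuU, D 0 u = u) ∧
      (∀ᵐ u ∂nuU, D 1 u = w u) ∧ ∀ t, TendstoInMeasure nuU D (𝓝 t) (D t) := by
  let w1 : ℝ → ℝ := fun u => max 0 (min 1 (w u))
  have hw1m : Measurable w1 := by
    have := hw.measurable
    fun_prop
  have hw1e : ∀ᵐ u ∂nuU, w1 u = w u := by
    filter_upwards [hw.quasiMeasurePreserving.ae nuU_mem] with u hu
    simp only [w1]
    rw [min_eq_right hu.2.le, max_eq_right hu.1.le]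
  have hw1 : MeasurePreserving w1 nuU nuU :=
    ⟨hw1m, (Measure.map_congr hw1e).trans hw.map_eq⟩
  have hb : ∀ u, |w1 u| ≤ 1 := by
    intro u
    rw [abs_of_nonneg (le_max_left _ _)]
    exact max_le zero_le_one (min_le_left _ _)
  let cl : ℝ → ℝ := fun t => max 0 (min 1 t)
  have hcl : ∀ t, cl t ∈ Icc (0:ℝ) 1 := fun t =>
    ⟨le_max_left _ _, max_le zero_le_one (min_le_left _ _)⟩
  have hclc : Continuous cl := by fun_prop
  refine ⟨fun t => dil w1 (cl t), fun t => dil_mp hw1 (hcl t), ?_, ?_, fun t => ?_⟩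
  · filter_upwards [nuU_mem] with u hu
    have : cl 0 = 0 := by simp [cl]
    simp only [this, dil]
    rw [if_neg (not_le.2 hu.1)]
  · filter_upwards [nuU_mem, hw1e] with u hu hu2
    have : cl 1 = 1 := by simp [cl]
    simp only [this, dil]
    rw [if_pos hu.2.le, div_one, one_mul, hu2]
  · refine (dil_cont hw1m hb (hcl t)).comp (ns := cl) ?_
    refine tendsto_nhdsWithin_iff.2 ⟨hclc.tendsto t, Eventually.of_forall hcl⟩

lemma tim_const {X S κ : Type*} [MeasurableSpace X] [PseudoMetricSpace S] {l : Filter κ}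
    (μ : Measure X) (f : X → S) : TendstoInMeasure μ (fun _ : κ => f) l f := by
  intro ε hε
  simp only [edist_self, nonpos_iff_eq_zero, hε.ne', ofPred_false, measure_empty]
  exact tendsto_const_nhds

set_option linter.unusedSectionVars false

section cells
variable {ι : Type*} [Fintype ι] [MeasurableSpace ι] [DiscreteMeasurableSpace ι]

/-- conditional law on a cell. -/
noncomputable def cellM (c : ℝ → ι) (i : ι) : Measure ℝ := ProbabilityTheory.cond nuU (c ⁻¹' {i})

lemma cellM_prob {c : ℝ → ι} {i : ι} (hi : nuU (c ⁻¹' {i}) ≠ 0) :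
    IsProbabilityMeasure (cellM c i) := ProbabilityTheory.cond_isProbabilityMeasure hi

lemma cellM_ac (c : ℝ → ι) (i : ι) : cellM c i ≪ nuU := ProbabilityTheory.cond_absolutelyContinuous

lemma cellM_na (c : ℝ → ι) (i : ι) : NullSingletonClass (cellM c i) :=
  ⟨fun x => cellM_ac c i (measure_singleton x)⟩

lemma cellM_mem {c : ℝ → ι} (hc : Measurable c) (i : ι) : ∀ᵐ u ∂(cellM c i), c u = i :=
  ProbabilityTheory.ae_cond_mem (hc (measurableSet_singleton i))

lemma cell_sum {c : ℝ → ι} (hc : Measurable c) :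
    ∑ i, nuU (c ⁻¹' {i}) • cellM c i = nuU :=
  ProbabilityTheory.sum_meas_smul_cond_fiber hc nuU

lemma cell_sum_apply {c : ℝ → ι} (hc : Measurable c) (B : Set ℝ) :
    nuU B = ∑ i, nuU (c ⁻¹' {i}) * cellM c i B := by
  conv_lhs => rw [← cell_sum hc]
  simp

lemma cell_ae {c : ℝ → ι} (hc : Measurable c) {Q : ℝ → Prop}
    (h : ∀ i, nuU (c ⁻¹' {i}) ≠ 0 → ∀ᵐ u ∂(cellM c i), Q u) : ∀ᵐ u ∂nuU, Q u := by
  rw [ae_iff, cell_sum_apply hc]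
  refine Finset.sum_eq_zero fun i _ => ?_
  by_cases hi : nuU (c ⁻¹' {i}) = 0
  · rw [hi, zero_mul]
  · have := h i hi
    rw [ae_iff] at this
    rw [this, mul_zero]

lemma cell_measurable {c : ℝ → ι} (hc : Measurable c) {G : ι → ℝ → ℝ}
    (hG : ∀ i, Measurable (G i)) : Measurable (fun u => G (c u) u) := by
  have : Measurable (fun p : ι × ℝ => G p.1 p.2) := measurable_from_prod_countable_right hG
  exact this.comp (hc.prodMk measurable_id)

lemma cell_mp {c c' : ℝ → ι} (hc : Measurable c) (hc' : Measurable c')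
    (hl : ∀ i, nuU (c ⁻¹' {i}) = nuU (c' ⁻¹' {i})) {G : ι → ℝ → ℝ}
    (hG : ∀ i, Measurable (G i))
    (hGm : ∀ i, nuU (c ⁻¹' {i}) ≠ 0 → MeasurePreserving (G i) (cellM c i) (cellM c' i)) :
    MeasurePreserving (fun u => G (c u) u) nuU nuU := by
  have hm := cell_measurable hc hG
  refine ⟨hm, ?_⟩
  ext B hB
  rw [Measure.map_apply hm hB, cell_sum_apply hc, cell_sum_apply hc' B]
  refine Finset.sum_congr rfl fun i _ => ?_
  rw [← hl i]
  by_cases hi : nuU (c ⁻¹' {i}) = 0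
  · rw [hi, zero_mul, zero_mul]
  · congr 1
    rw [← (hGm i hi).measure_preimage hB.nullMeasurableSet]
    apply measure_congr
    filter_upwards [cellM_mem hc i] with u hu
    change (G (c u) u ∈ B) = (G i u ∈ B)
    rw [hu]

lemma cell_tim {c : ℝ → ι} (hc : Measurable c) {κ : Type*} {l : Filter κ}
    {G : κ → ι → ℝ → ℝ} {G0 : ι → ℝ → ℝ}
    (h : ∀ i, nuU (c ⁻¹' {i}) ≠ 0 → TendstoInMeasure (cellM c i) (fun k => G k i) l (G0 i)) :
    TendstoInMeasure nuU (fun k u => G k (c u) u) l (fun u => G0 (c u) u) := by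
  intro ε hε
  rw [show (fun k => nuU {u | ε ≤ edist (G k (c u) u) (G0 (c u) u)}) = fun k =>
    ∑ i, nuU (c ⁻¹' {i}) * cellM c i {u | ε ≤ edist (G k (c u) u) (G0 (c u) u)} from
    funext fun k => cell_sum_apply hc _]
  rw [← Finset.sum_const_zero (s := (Finset.univ : Finset ι))]
  refine tendsto_finsetSum _ fun i _ => ?_
  by_cases hi : nuU (c ⁻¹' {i}) = 0
  · simp only [hi, zero_mul]; exact tendsto_const_nhds
  · have h1 := ENNReal.Tendsto.const_mul (a := nuU (c ⁻¹' {i})) (h i hi ε hε)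
      (Or.inr (measure_ne_top _ _))
    rw [mul_zero] at h1
    refine h1.congr fun k => ?_
    congr 1
    apply measure_congr
    filter_upwards [cellM_mem hc i] with u hu
    change (ε ≤ edist (G k i u) (G0 i u)) = (ε ≤ edist (G k (c u) u) (G0 (c u) u))
    rw [hu]

lemma cell_restrict_mp {c c' : ℝ → ι} (hc : Measurable c) (hc' : Measurable c')
    {V : ℝ → ℝ} (hV : MeasurePreserving V nuU nuU) (hVc : ∀ᵐ u ∂nuU, c' (V u) = c u) (i : ι) :
    MeasurePreserving V (cellM c i) (cellM c' i) := by
  refine ⟨hV.measurable, ?_⟩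
  have key : ∀ B, MeasurableSet B → nuU (c ⁻¹' {i} ∩ V ⁻¹' B) = nuU (c' ⁻¹' {i} ∩ B) := by
    intro B hB
    rw [← hV.measure_preimage ((hc' (measurableSet_singleton i)).inter hB).nullMeasurableSet]
    apply measure_congr
    filter_upwards [hVc] with u hu
    change (c u = i ∧ V u ∈ B) = (c' (V u) = i ∧ V u ∈ B)
    rw [hu]
  ext B hB
  rw [Measure.map_apply hV.measurable hB, cellM, cellM,
    ProbabilityTheory.cond_apply (hc (measurableSet_singleton i)),
    ProbabilityTheory.cond_apply (hc' (measurableSet_singleton i)), key B hB]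
  have := key univ MeasurableSet.univ
  simp only [preimage_univ, inter_univ] at this
  rw [this]

/-- canonical cell-respecting isomorphism. -/
noncomputable def cellV (c c' : ℝ → ι) (u : ℝ) : ℝ :=
  qt (cellM c' (c u)) (ProbabilityTheory.cdf (cellM c (c u)) u)

lemma cell_path {c c' : ℝ → ι} (hc : Measurable c) (hc' : Measurable c')
    (hl : ∀ i, nuU (c ⁻¹' {i}) = nuU (c' ⁻¹' {i}))
    {V' : ℝ → ℝ} (hV' : MeasurePreserving V' nuU nuU) (hVc' : ∀ᵐ u ∂nuU, c' (V' u) = c u) :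
    ∃ Γ : ℝ → ℝ → ℝ, (∀ t, MeasurePreserving (Γ t) nuU nuU) ∧
      (∀ t, ∀ᵐ u ∂nuU, c' (Γ t u) = c u) ∧
      (∀ᵐ u ∂nuU, Γ 0 u = cellV c c' u) ∧ (∀ᵐ u ∂nuU, Γ 1 u = V' u) ∧
      ∀ t, TendstoInMeasure nuU Γ (𝓝 t) (Γ t) := by
  have hD : ∀ i, ∃ D : ℝ → ℝ → ℝ, (∀ t, MeasurePreserving (D t) nuU nuU) ∧
      (∀ᵐ u ∂nuU, D 0 u = u) ∧
      (nuU (c ⁻¹' {i}) ≠ 0 → ∀ᵐ u ∂nuU, D 1 u =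
        ProbabilityTheory.cdf (cellM c' i) (V' (qt (cellM c i) u))) ∧
      ∀ t, TendstoInMeasure nuU D (𝓝 t) (D t) := by
    intro i
    by_cases hi : nuU (c ⁻¹' {i}) = 0
    · refine ⟨fun _ u => u, fun _ => MeasurePreserving.id _, ae_of_all _ fun _ => rfl,
        fun h => absurd hi h, fun t => ?_⟩
      intro ε hε
      simp [hε.not_ge]
    · have := cellM_prob hi
      have := cellM_na c i
      have hi' : nuU (c' ⁻¹' {i}) ≠ 0 := by rwa [← hl i]
      have := cellM_prob hi'
      have := cellM_na c' i
      have hw := ((exists_iso_real (cellM c' i)).1.comp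
        (cell_restrict_mp hc hc' hV' hVc' i)).comp (exists_iso_real (cellM c i)).2.1
      obtain ⟨D, h1, h2, h3, h4⟩ := exists_dil_path hw
      exact ⟨D, h1, h2, fun _ => h3, h4⟩
  choose D hD1 hD2 hD3 hD4 using hD
  let G : ℝ → ι → ℝ → ℝ := fun t i u =>
    qt (cellM c' i) (D i t (ProbabilityTheory.cdf (cellM c i) u))
  have hcdf : ∀ i, Measurable (ProbabilityTheory.cdf (cellM c i)) := fun i =>
    (ProbabilityTheory.cdf (cellM c i)).mono.measurable
  have hG : ∀ t i, Measurable (G t i) := fun t i =>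
    (measurable_qt' _).comp ((hD1 i t).measurable.comp (hcdf i))
  have hGm : ∀ t i, nuU (c ⁻¹' {i}) ≠ 0 →
      MeasurePreserving (G t i) (cellM c i) (cellM c' i) := by
    intro t i hi
    have := cellM_prob hi
    have := cellM_na c i
    have hi' : nuU (c' ⁻¹' {i}) ≠ 0 := by rwa [← hl i]
    have := cellM_prob hi'
    have := cellM_na c' i
    exact (exists_iso_real (cellM c' i)).2.1.comp
      ((hD1 i t).comp (exists_iso_real (cellM c i)).1)
  refine ⟨fun t u => G t (c u) u, fun t => cell_mp hc hc' hl (hG t) (hGm t), ?_, ?_, ?_, ?_⟩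
  · intro t
    refine cell_ae hc fun i hi => ?_
    filter_upwards [cellM_mem hc i,
      (hGm t i hi).quasiMeasurePreserving.ae (cellM_mem hc' i)] with u hu hu2
    rw [hu, hu2]
  · refine cell_ae hc fun i hi => ?_
    have := cellM_prob hi
    have := cellM_na c i
    filter_upwards [cellM_mem hc i,
      (exists_iso_real (cellM c i)).1.quasiMeasurePreserving.ae (hD2 i)] with u hu hu2
    simp only [G, cellV, hu, hu2]
  · refine cell_ae hc fun i hi => ?_
    have := cellM_prob hi
    have := cellM_na c i
    have hi' : nuU (c' ⁻¹' {i}) ≠ 0 := by rwa [← hl i]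
    have := cellM_prob hi'
    have := cellM_na c' i
    filter_upwards [cellM_mem hc i,
      (exists_iso_real (cellM c i)).1.quasiMeasurePreserving.ae (hD3 i hi),
      (exists_iso_real (cellM c i)).2.2.1,
      (cell_restrict_mp hc hc' hV' hVc' i).quasiMeasurePreserving.ae
        (exists_iso_real (cellM c' i)).2.2.1] with u hu hu2 hu3 hu4
    simp only [G, hu, hu2, hu3, hu4]
  · intro t
    refine cell_tim hc fun i hi => ?_
    have := cellM_prob hi
    have := cellM_na c i
    have hi' : nuU (c' ⁻¹' {i}) ≠ 0 := by rwa [← hl i]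
    have := cellM_prob hi'
    have := cellM_na c' i
    have hh := (exists_iso_real (cellM c i)).1
    have h1 : TendstoInMeasure (cellM c i)
        (fun s => D i s ∘ ProbabilityTheory.cdf (cellM c i)) (𝓝 t)
        (D i t ∘ ProbabilityTheory.cdf (cellM c i)) :=
      tim_comp (cellM c i) nuU (V := fun _ => ProbabilityTheory.cdf (cellM c i))
        (Eventually.of_forall fun _ => hh) hh (tim_const _ _)
        (Eventually.of_forall fun s => (hD1 i s).measurable) (hD1 i t).measurable (hD4 i t)
    exact tim_comp (cellM c i) nuU (A := fun _ => qt (cellM c' i)) (A0 := qt (cellM c' i))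
      (V := fun s => D i s ∘ ProbabilityTheory.cdf (cellM c i))
      (V0 := D i t ∘ ProbabilityTheory.cdf (cellM c i))
      (Eventually.of_forall fun s => (hD1 i s).comp hh) ((hD1 i t).comp hh) h1
      (Eventually.of_forall fun s => measurable_qt' _) (measurable_qt' _) (tim_const _ _)

lemma cellV_mp {c c' : ℝ → ι} (hc : Measurable c) (hc' : Measurable c')
    (hl : ∀ i, nuU (c ⁻¹' {i}) = nuU (c' ⁻¹' {i})) :
    MeasurePreserving (cellV c c') nuU nuU ∧ (∀ᵐ u ∂nuU, c' (cellV c c' u) = c u) := by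
  have hcdf : ∀ i, Measurable (ProbabilityTheory.cdf (cellM c i)) := fun i =>
    (ProbabilityTheory.cdf (cellM c i)).mono.measurable
  let G : ι → ℝ → ℝ := fun i u =>
    qt (cellM c' i) (ProbabilityTheory.cdf (cellM c i) u)
  have hGm : ∀ i, nuU (c ⁻¹' {i}) ≠ 0 →
      MeasurePreserving (G i) (cellM c i) (cellM c' i) := by
    intro i hi
    have := cellM_prob hi
    have := cellM_na c i
    have hi' : nuU (c' ⁻¹' {i}) ≠ 0 := by rwa [← hl i]
    have := cellM_prob hi'
    have := cellM_na c' i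
    exact (exists_iso_real (cellM c' i)).2.1.comp (exists_iso_real (cellM c i)).1
  refine ⟨cell_mp hc hc' hl (G := G) (fun i => (measurable_qt' _).comp (hcdf i)) hGm, ?_⟩
  refine cell_ae hc fun i hi => ?_
  filter_upwards [cellM_mem hc i,
    (hGm i hi).quasiMeasurePreserving.ae (cellM_mem hc' i)] with u hu hu2
  simp only [G] at hu2
  rw [cellV, hu, hu2]

lemma cellV_self {c : ℝ → ι} (hc : Measurable c) : ∀ᵐ u ∂nuU, cellV c c u = u := by
  refine cell_ae hc fun i hi => ?_
  have := cellM_prob hi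
  have := cellM_na c i
  filter_upwards [cellM_mem hc i, (exists_iso_real (cellM c i)).2.2.1] with u hu hu3
  rw [cellV, hu, hu3]

end cells

/-- a countable family of balls, radii scaled by `r`. -/
noncomputable def ballSeq (S : Type*) [MetricSpace S] [TopologicalSpace.SeparableSpace S]
    [Nonempty S] (r : ℝ) (j : ℕ) : Set S :=
  Metric.ball (TopologicalSpace.denseSeq S j.unpair.1) (r / (j.unpair.2 + 1))

lemma ballSeq_small {S : Type*} [MetricSpace S] [TopologicalSpace.SeparableSpace S]
    [Nonempty S] {r : ℝ} (hr : 0 < r) {ε : ℝ} (hε : 0 < ε) (y : S) :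
    ∃ j, y ∈ ballSeq S r j ∧ ∀ z ∈ ballSeq S r j, ∀ w ∈ ballSeq S r j, dist z w < ε := by
  obtain ⟨k, hk⟩ := exists_nat_gt (2 * r / ε)
  have hk1 : (0:ℝ) < k + 1 := by positivity
  have hrk : 0 < r / ((k:ℝ) + 1) := by positivity
  obtain ⟨i, hi⟩ := (TopologicalSpace.denseRange_denseSeq S).exists_dist_lt y hrk
  have h2 : r / ((k:ℝ) + 1) < ε / 2 := by
    rw [div_lt_iff₀ hε] at hk
    rw [div_lt_iff₀ hk1]
    nlinarith
  refine ⟨Nat.pair i k, ?_, ?_⟩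
  · simp only [ballSeq, Nat.unpair_pair, Metric.mem_ball]; exact hi
  · intro z hz w hw
    simp only [ballSeq, Nat.unpair_pair, Metric.mem_ball] at hz hw
    have := dist_triangle_right z w (TopologicalSpace.denseSeq S i)
    linarith

open Classical in
lemma half_lemma {S : Type*} [MetricSpace S] [MeasurableSpace S] [BorelSpace S]
    [TopologicalSpace.SeparableSpace S] {f x : ℝ → S} (hf : Measurable f) (hx : Measurable x)
    (hfx : nuU.map f = nuU.map x) :
    ∃ V : ℝ → ℝ → ℝ, (∀ s, MeasurePreserving (V s) nuU nuU) ∧ (∀ᵐ u ∂nuU, V 0 u = u) ∧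
      (∀ s, TendstoInMeasure nuU V (𝓝 s) (V s)) ∧
      TendstoInMeasure nuU (fun s => f ∘ V s) atTop x := by
  have : Nonempty S := ⟨f 0⟩
  let e : (n : ℕ) → S → (Fin n → Bool) := fun n y j => decide (y ∈ ballSeq S 1 j)
  have he : ∀ n, Measurable (e n) := by
    intro n
    refine measurable_pi_lambda _ fun j => ?_
    refine measurable_to_bool ?_
    have : (fun y => e n y j) ⁻¹' {true} = ballSeq S 1 j := by ext y; simp [e]
    rw [this]
    exact Metric.isOpen_ball.measurableSet
  have hc : ∀ n, Measurable (e n ∘ x) := fun n => (he n).comp hx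
  have hc' : ∀ n, Measurable (e n ∘ f) := fun n => (he n).comp hf
  have hl : ∀ n i, nuU ((e n ∘ x) ⁻¹' {i}) = nuU ((e n ∘ f) ⁻¹' {i}) := by
    intro n i
    rw [preimage_comp, preimage_comp, ← Measure.map_apply hx (he n (measurableSet_singleton i)),
      ← Measure.map_apply hf (he n (measurableSet_singleton i)), hfx]
  have hA := fun n => cellV_mp (hc n) (hc' n) (hl n)
  have hAn : ∀ n, ∀ᵐ u ∂nuU, (e n ∘ f) (cellV (e (n+1) ∘ x) (e (n+1) ∘ f) u) = (e n ∘ x) u := by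
    intro n
    filter_upwards [(hA (n+1)).2] with u hu
    funext j
    exact congrFun hu j.castSucc
  choose Γ h1 h2 h3 h4 h5 using fun n => cell_path (hc n) (hc' n) (hl n) (hA (n+1)).1 (hAn n)
  have hglue : ∀ n, ∀ᵐ u ∂nuU, Γ n 1 u = Γ (n+1) 0 u := by
    intro n
    filter_upwards [h4 n, h3 (n+1)] with u hu hu2
    rw [hu, hu2]
  let V : ℝ → ℝ → ℝ := fun s => Γ ⌊s⌋₊ (s - ⌊s⌋₊)
  have hpiece : ∀ n : ℕ, ∀ s : ℝ, TendstoInMeasure nuU (fun t => Γ n (t - n)) (𝓝 s) (Γ n (s - n)) := by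
    intro n s ε hε
    have := h5 n (s - n) ε hε
    exact this.comp (((continuous_id.sub continuous_const).tendsto s))
  refine ⟨V, fun s => h1 _ _, ?_, ?_, ?_⟩
  · have h0 : e 0 ∘ x = e 0 ∘ f := Subsingleton.elim _ _
    filter_upwards [h3 0, cellV_self (hc' 0)] with u hu hu2
    simp only [V, Nat.floor_zero, CharP.cast_eq_zero, sub_zero]
    rw [hu, h0, hu2]
  · intro s
    have hr : TendstoInMeasure nuU V (𝓝[≥] s) (V s) := by
      refine TendstoInMeasure.congr' (f := fun t => Γ ⌊s⌋₊ (t - ⌊s⌋₊)) (g := V s) ?_ EventuallyEq.rfl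
        (fun ε hε => (hpiece _ s ε hε).mono_left nhdsWithin_le_nhds)
      have : ∀ᶠ t in 𝓝[≥] s, t < (⌊s⌋₊:ℝ) + 1 :=
        nhdsWithin_le_nhds (eventually_lt_nhds (Nat.lt_floor_add_one s))
      filter_upwards [this, self_mem_nhdsWithin] with t ht hst
      have : ⌊t⌋₊ = ⌊s⌋₊ := by
        apply le_antisymm
        · exact Nat.lt_succ_iff.1 (Nat.floor_lt' (by omega) |>.2 (by push_cast; exact ht))
        · exact Nat.floor_le_floor hst
      simp only [V, this]; rfl
    have hlft : TendstoInMeasure nuU V (𝓝[<] s) (V s) := by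
      by_cases hs : s ≤ 0
      · have hs0 : ⌊s⌋₊ = 0 := Nat.floor_of_nonpos hs
        refine TendstoInMeasure.congr' (f := fun t => Γ 0 (t - (0:ℕ))) (g := Γ 0 (s - (0:ℕ))) ?_ ?_
          (fun ε hε => (hpiece _ s ε hε).mono_left nhdsWithin_le_nhds)
        · filter_upwards [self_mem_nhdsWithin] with t ht
          have : ⌊t⌋₊ = 0 := Nat.floor_of_nonpos ((le_of_lt ht).trans hs)
          simp only [V, this]; rfl
        · simp only [V, hs0]; rfl
      · push Not at hs
        by_cases hsf : s = ⌊s⌋₊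
        · obtain ⟨n, hn⟩ : ∃ n, ⌊s⌋₊ = n + 1 := by
            refine Nat.exists_eq_succ_of_ne_zero fun h => ?_
            rw [h] at hsf; simp at hsf; exact hs.ne' hsf
          rw [hn] at hsf
          refine TendstoInMeasure.congr' (f := fun t => Γ n (t - n)) (g := Γ n (s - n)) ?_ ?_
            (fun ε hε => (hpiece _ s ε hε).mono_left nhdsWithin_le_nhds)
          · have : ∀ᶠ t in 𝓝[<] s, (n:ℝ) < t :=
              nhdsWithin_le_nhds (eventually_gt_nhds (by rw [hsf]; push_cast; linarith))
            filter_upwards [this, self_mem_nhdsWithin] with t ht hst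
            have : ⌊t⌋₊ = n := by
              rw [Nat.floor_eq_iff ((Nat.cast_nonneg n).trans ht.le)]
              refine ⟨ht.le, ?_⟩
              have hst' : t < s := hst
              rw [hsf] at hst'; push_cast at hst'; exact hst'
            simp only [V, this]; rfl
          · filter_upwards [hglue n] with u hu
            have e1 : s - n = 1 := by rw [hsf]; push_cast; ring
            have e2 : s - (n+1:ℕ) = 0 := by rw [← hsf]; ring
            simp only [V, hn]
            rw [e1, e2, hu]
        · have hlt : (⌊s⌋₊:ℝ) < s := lt_of_le_of_ne (Nat.floor_le hs.le) (Ne.symm hsf)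
          refine TendstoInMeasure.congr' (f := fun t => Γ ⌊s⌋₊ (t - ⌊s⌋₊)) (g := V s) ?_
            EventuallyEq.rfl (fun ε hε => (hpiece _ s ε hε).mono_left nhdsWithin_le_nhds)
          have : ∀ᶠ t in 𝓝[<] s, (⌊s⌋₊:ℝ) < t := nhdsWithin_le_nhds (eventually_gt_nhds hlt)
          filter_upwards [this, self_mem_nhdsWithin] with t ht hst
          have : ⌊t⌋₊ = ⌊s⌋₊ := by
            rw [Nat.floor_eq_iff ((Nat.cast_nonneg _).trans ht.le)]
            exact ⟨ht.le, (show t < s from hst).trans (Nat.lt_floor_add_one s)⟩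
          simp only [V, this]; rfl
    intro ε hε
    rw [← nhdsLT_sup_nhdsGE]
    exact (hlft ε hε).sup (hr ε hε)
  · rw [tendstoInMeasure_iff_dist]
    intro ε hε
    let A : ℕ → Set S := fun k => ballSeq S 1 k ∩
      {_y | ∀ z ∈ ballSeq S 1 k, ∀ w ∈ ballSeq S 1 k, dist z w < ε}
    have hAm : ∀ k, MeasurableSet (A k) := fun k =>
      Metric.isOpen_ball.measurableSet.inter (MeasurableSet.const _)
    have hAc : ∀ y, ∃ k, y ∈ A k := by
      intro y
      obtain ⟨j, hj, hj2⟩ := ballSeq_small one_pos hε y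
      exact ⟨j, hj, hj2⟩
    have := (exists_small_cells nuU x hx A hAm hAc).comp (tendsto_nat_floor_atTop (α := ℝ))
    refine tendsto_of_tendsto_of_tendsto_of_le_of_le tendsto_const_nhds this (fun _ => zero_le) ?_
    intro s
    apply measure_mono_ae
    filter_upwards [h2 ⌊s⌋₊ (s - ⌊s⌋₊)] with u hu hεu k hk hxk
    have h3 := congrFun hu ⟨k, hk⟩
    simp only [Function.comp, e, decide_eq_decide] at h3
    have := hxk.2 _ (h3.2 hxk.1) _ hxk.1
    exact absurd this (not_lt.2 hεu)

lemma exists_nonatom (ρ : Measure ℝ) [IsFiniteMeasure ρ] {a b : ℝ} (h : a < b) :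
    ∃ x ∈ Ioo a b, ρ {x} = 0 := by
  by_contra! hcon
  have hc : Set.Countable {t : ℝ | 0 < ρ {a : ℝ | id a = t}} :=
    Measure.countable_meas_level_set_pos measurable_id
  have : Set.Countable (Ioo a b) := hc.mono fun x hx => by
    have := hcon x hx
    exact pos_iff_ne_zero.2 this
  exact (Cardinal.Real.Ioo_countable_iff.1 this).not_gt h

lemma qt_tendsto (ρ : Measure ℝ) [IsProbabilityMeasure ρ] (ρs : ℕ → Measure ℝ)
    (h : ∀ x, ρ {x} = 0 → Tendsto (fun k => ProbabilityTheory.cdf (ρs k) x) atTop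
      (𝓝 (ProbabilityTheory.cdf ρ x))) :
    ∀ᵐ u ∂nuU, Tendsto (fun k => qt (ρs k) u) atTop (𝓝 (qt ρ u)) := by
  have hcount : (range fun c : ℚ => ProbabilityTheory.cdf ρ c).Countable := countable_range _
  have hae : ∀ᵐ u ∂nuU, u ∉ range fun c : ℚ => ProbabilityTheory.cdf ρ c :=
    hcount.ae_notMem nuU
  filter_upwards [hae, nuU_mem] with u hu hu01
  rw [tendsto_order]
  constructor
  · intro a ha
    obtain ⟨x, hx, hx0⟩ := exists_nonatom ρ ha
    have h1 : ProbabilityTheory.cdf ρ x < u := by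
      by_contra! hcon
      exact absurd ((qt_le_iff ρ hu01 x).2 hcon) (not_le.2 hx.2)
    filter_upwards [(h x hx0).eventually_lt_const h1] with k hk
    by_contra! hcon
    exact absurd ((qt_le_iff (ρs k) hu01 x).1 (hcon.trans hx.1.le)) (not_le.2 hk)
  · intro b hb
    obtain ⟨c, hc1, hc2⟩ := exists_rat_btwn hb
    obtain ⟨x, hx, hx0⟩ := exists_nonatom ρ hc2
    have h1 : u < ProbabilityTheory.cdf ρ x := by
      have h2 : u ≤ ProbabilityTheory.cdf ρ c := (qt_le_iff ρ hu01 c).1 hc1.le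
      have h3 : u ≠ ProbabilityTheory.cdf ρ c := fun h => hu ⟨c, h.symm⟩
      exact (lt_of_le_of_ne h2 h3).trans_le ((ProbabilityTheory.cdf ρ).mono hx.1.le)
    filter_upwards [(h x hx0).eventually_const_lt h1] with k hk
    exact ((qt_le_iff (ρs k) hu01 x).2 hk.le).trans_lt hx.2

lemma cantor_continuous : Continuous (Cardinal.cantorFunction (1/3)) := by
  unfold Cardinal.cantorFunction
  refine continuous_tsum (u := fun n => (1/3 : ℝ)^n) (fun n => ?_) 
    (summable_geometric_of_lt_one (by norm_num) (by norm_num)) ?_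
  · have : (fun f => Cardinal.cantorFunctionAux (1/3) f n) =
      (fun b : Bool => cond b ((1/3:ℝ)^n) 0) ∘ (fun f : ℕ → Bool => f n) := by
      funext f; rfl
    rw [this]
    exact continuous_of_discreteTopology.comp (continuous_apply n)
  · intro n f
    unfold Cardinal.cantorFunctionAux
    cases f n <;> simp

lemma cantor_embedding : IsClosedEmbedding (Cardinal.cantorFunction (1/3)) :=
  cantor_continuous.isClosedEmbedding
    (Cardinal.cantorFunction_injective (by norm_num) (by norm_num))

section skor
variable {S : Type*} [MetricSpace S] [TopologicalSpace.SeparableSpace S]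
    [Nonempty S]

open Classical in
/-- binary code of a point with respect to balls scaled by `exp r`. -/
noncomputable def codeS (r : ℝ) (y : S) : ℕ → Bool := fun j => decide (y ∈ ballSeq S (Real.exp r) j)

/-- real code. -/
noncomputable def hS (r : ℝ) (y : S) : ℝ := Cardinal.cantorFunction (1/3) (codeS r y)

lemma tendsto_of_hS {r : ℝ} {ys : ℕ → S} {y : S}
    (h : Tendsto (fun k => hS r (ys k)) atTop (𝓝 (hS r y))) : Tendsto ys atTop (𝓝 y) := by
  have h1 : Tendsto (fun k => codeS r (ys k)) atTop (𝓝 (codeS r y)) :=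
    cantor_embedding.isEmbedding.isInducing.tendsto_nhds_iff.2 h
  rw [Metric.tendsto_nhds]
  intro ε hε
  obtain ⟨j, hj, hj2⟩ := ballSeq_small (Real.exp_pos r) hε y
  have h2 := (tendsto_pi_nhds.1 h1) j
  rw [nhds_discrete, tendsto_pure] at h2
  filter_upwards [h2] with k hk
  simp only [codeS, decide_eq_decide] at hk
  exact hj2 _ (hk.2 hj) _ hj

lemma hS_injective (r : ℝ) : Function.Injective (hS r : S → ℝ) := by
  intro y z hyz
  have h1 : Tendsto (fun _ : ℕ => y) atTop (𝓝 z) :=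
    tendsto_of_hS (r := r) (by rw [hyz]; exact tendsto_const_nhds)
  exact tendsto_nhds_unique tendsto_const_nhds h1

lemma hS_continuousAt {r : ℝ} {y : S}
    (h : ∀ j : ℕ, dist y (TopologicalSpace.denseSeq S j.unpair.1) ≠
      Real.exp r / (j.unpair.2 + 1)) : ContinuousAt (hS r) y := by
  refine cantor_continuous.continuousAt.comp ?_
  rw [continuousAt_pi]
  intro j
  unfold ContinuousAt
  rw [nhds_discrete Bool, tendsto_pure]
  have hd : ContinuousAt (fun z => dist z (TopologicalSpace.denseSeq S j.unpair.1)) y :=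
    (continuous_id.dist continuous_const).continuousAt
  rcases lt_or_gt_of_ne (h j) with h1 | h1
  · filter_upwards [hd.eventually_lt_const h1] with z hz
    simp only [codeS, ballSeq, Metric.mem_ball, hz, h1]
  · filter_upwards [hd.eventually_const_lt h1] with z hz
    simp only [codeS, ballSeq, Metric.mem_ball, hz.not_gt, h1.not_gt]

variable [MeasurableSpace S] [BorelSpace S]

lemma measurable_hS : Measurable (fun p : ℝ × S => hS p.1 p.2) := by
  refine cantor_continuous.measurable.comp ?_
  refine measurable_pi_lambda _ fun j => ?_
  refine measurable_to_bool ?_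
  have : (fun p : ℝ × S => codeS p.1 p.2 j) ⁻¹' {true} =
    {p : ℝ × S | dist p.2 (TopologicalSpace.denseSeq S j.unpair.1) <
      Real.exp p.1 / (j.unpair.2 + 1)} := by ext p; simp [codeS, ballSeq]
  rw [this]
  exact measurableSet_lt (by fun_prop) (by fun_prop)

lemma hS_meas (r : ℝ) : Measurable (hS r : S → ℝ) :=
  measurable_hS.comp (measurable_const.prodMk measurable_id)

lemma exists_gS [CompleteSpace S] : ∃ g : ℝ × ℝ → S, Measurable g ∧ ∀ r y, g (r, hS r y) = y := by
  have h1 : Measurable (fun p : ℝ × S => (p.1, hS p.1 p.2)) :=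
    measurable_fst.prodMk measurable_hS
  have h2 : Function.Injective (fun p : ℝ × S => (p.1, hS p.1 p.2)) := by
    rintro ⟨r, y⟩ ⟨r', y'⟩ h
    simp only [Prod.mk.injEq] at h
    obtain ⟨rfl, h⟩ := h
    rw [hS_injective r h]
  obtain ⟨g, hg, hg2⟩ := (h1.measurableEmbedding h2).exists_measurable_extend
    (measurable_snd (α := ℝ) (β := S)) (fun _ => inferInstance)
  exact ⟨g, hg, fun r y => congrFun hg2 (r, y)⟩

lemma sphere_null (μ : Measure S) [IsFiniteMeasure μ] :
    ∀ᵐ r ∂nuU, ∀ᵐ y ∂μ, ∀ j : ℕ, dist y (TopologicalSpace.denseSeq S j.unpair.1) ≠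
      Real.exp r / (j.unpair.2 + 1) := by
  have hm : MeasurableSet {p : ℝ × S | ∀ j : ℕ,
      dist p.2 (TopologicalSpace.denseSeq S j.unpair.1) ≠ Real.exp p.1 / (j.unpair.2 + 1)} := by
    rw [show {p : ℝ × S | ∀ j : ℕ,
      dist p.2 (TopologicalSpace.denseSeq S j.unpair.1) ≠ Real.exp p.1 / (j.unpair.2 + 1)} =
      ⋂ j : ℕ, {p : ℝ × S | dist p.2 (TopologicalSpace.denseSeq S j.unpair.1) =
        Real.exp p.1 / (j.unpair.2 + 1)}ᶜ by ext p; simp]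
    exact MeasurableSet.iInter fun j =>
      (measurableSet_eq_fun (by fun_prop) (by fun_prop)).compl
  rw [← Measure.ae_prod_iff_ae_ae (p := fun p : ℝ × S => ∀ j : ℕ,
      dist p.2 (TopologicalSpace.denseSeq S j.unpair.1) ≠ Real.exp p.1 / (j.unpair.2 + 1)) hm]
  rw [Measure.ae_prod_iff_ae_ae hm, Measure.ae_ae_comm hm]
  refine ae_of_all _ fun y => ?_
  rw [ae_all_iff]
  intro j
  have : (({r : ℝ | dist y (TopologicalSpace.denseSeq S j.unpair.1) =
      Real.exp r / (j.unpair.2 + 1)}).Subsingleton) := by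
    intro r hr r' hr'
    have h3 : Real.exp r / ((j.unpair.2:ℝ) + 1) = Real.exp r' / (j.unpair.2 + 1) :=
      (show _ = _ from hr).symm.trans hr'
    have h4 : ((j.unpair.2:ℝ) + 1) ≠ 0 := by positivity
    exact Real.exp_injective ((div_left_inj' h4).1 h3)
  exact this.countable.ae_notMem nuU

lemma cdf_conv {r : ℝ} {μ : ProbabilityMeasure S} {μs : ℕ → ProbabilityMeasure S}
    (hμ : Tendsto μs atTop (𝓝 μ))
    (hr : ∀ᵐ y ∂(μ : Measure S), ∀ j : ℕ, dist y (TopologicalSpace.denseSeq S j.unpair.1) ≠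
      Real.exp r / (j.unpair.2 + 1)) (x : ℝ) (hx : ((μ : Measure S).map (hS r)) {x} = 0) :
    Tendsto (fun k => ProbabilityTheory.cdf ((μs k : Measure S).map (hS r)) x) atTop
      (𝓝 (ProbabilityTheory.cdf ((μ : Measure S).map (hS r)) x)) := by
  have hcdf : ∀ ν : ProbabilityMeasure S, ProbabilityTheory.cdf ((ν : Measure S).map (hS r)) x =
      ((ν : Measure S) (hS r ⁻¹' Iic x)).toReal := by
    intro ν
    have : IsProbabilityMeasure ((ν : Measure S).map (hS r)) :=
      Measure.isProbabilityMeasure_map (hS_meas r).aemeasurable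
    rw [ProbabilityTheory.cdf_eq_real, measureReal_def, Measure.map_apply (hS_meas r) measurableSet_Iic]
  simp_rw [hcdf]
  refine (ENNReal.tendsto_toReal (measure_ne_top _ _)).comp ?_
  refine ProbabilityMeasure.tendsto_measure_of_null_frontier_of_tendsto' hμ ?_
  rw [Measure.map_apply (hS_meas r) (measurableSet_singleton x)] at hx
  have hx' : ∀ᵐ y ∂(μ : Measure S), hS r y ≠ x := measure_eq_zero_iff_ae_notMem.1 hx
  rw [measure_eq_zero_iff_ae_notMem]
  filter_upwards [hr, hx'] with y hy hyx hfr
  have hc := hS_continuousAt hy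
  rcases lt_or_gt_of_ne hyx with h1 | h1
  · have h2 : hS r ⁻¹' Iic x ∈ 𝓝 y := by
      filter_upwards [hc.eventually_lt_const h1] with z hz using hz.le
    exact hfr.2 (mem_interior_iff_mem_nhds.2 h2)
  · have h2 : (hS r ⁻¹' Iic x)ᶜ ∈ 𝓝 y := by
      filter_upwards [hc.eventually_const_lt h1] with z hz using not_le.2 hz
    have h3 := mem_interior_iff_mem_nhds.2 h2
    rw [interior_compl] at h3
    exact h3 hfr.1

set_option maxHeartbeats 1000000 in
lemma skorokhod_prod [CompleteSpace S] (β : ℝ → ProbabilityMeasure S) (hβ : Continuous β) :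
    ∃ Y : ℝ → ℝ × ℝ → S, (∀ t, Measurable (Y t)) ∧
      (∀ t, (nuU.prod nuU).map (Y t) = β t) ∧
      ∀ t, TendstoInMeasure (nuU.prod nuU) Y (𝓝 t) (Y t) := by
  obtain ⟨g, hg, hgh⟩ := exists_gS (S := S)
  have hpr : ∀ t r, IsProbabilityMeasure ((β t : Measure S).map (hS r)) := fun t r =>
    Measure.isProbabilityMeasure_map (hS_meas r).aemeasurable
  have hqm : ∀ t, Measurable (fun p : ℝ × ℝ => qt ((β t : Measure S).map (hS p.1)) p.2) := by
    intro t
    refine measurable_qt (fun r => (β t : Measure S).map (hS r)) fun x => ?_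
    have : ∀ r, ProbabilityTheory.cdf ((β t : Measure S).map (hS r)) x =
        ((β t : Measure S) (Prod.mk r ⁻¹' {p : ℝ × S | hS p.1 p.2 ≤ x})).toReal := by
      intro r
      have := hpr t r
      rw [ProbabilityTheory.cdf_eq_real, measureReal_def,
        Measure.map_apply (hS_meas r) measurableSet_Iic]
      rfl
    simp_rw [this]
    exact (measurable_measure_prodMk_left
      (measurableSet_le measurable_hS measurable_const)).ennreal_toReal
  let Y : ℝ → ℝ × ℝ → S := fun t p => g (p.1, qt ((β t : Measure S).map (hS p.1)) p.2)
  have hY : ∀ t, Measurable (Y t) := fun t => hg.comp (measurable_fst.prodMk (hqm t))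
  have hgr : ∀ r, Measurable (fun z => g (r, z)) := fun r =>
    hg.comp (measurable_const.prodMk measurable_id)
  refine ⟨Y, hY, ?_, ?_⟩
  · intro t
    ext B hB
    rw [Measure.map_apply (hY t) hB, Measure.prod_apply (hY t hB)]
    have : ∀ r, nuU (Prod.mk r ⁻¹' (Y t ⁻¹' B)) = (β t : Measure S) B := by
      intro r
      have := hpr t r
      have e1 : Prod.mk r ⁻¹' (Y t ⁻¹' B) =
        qt ((β t : Measure S).map (hS r)) ⁻¹' ((fun z => g (r, z)) ⁻¹' B) := rfl
      rw [e1, ← Measure.map_apply (measurable_qt' _) (hgr r hB), map_qt,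
        Measure.map_apply (hS_meas r) (hgr r hB)]
      congr 1
      ext y
      simp [hgh]
    simp_rw [this]
    simp
  · intro t ε hε
    refine tendsto_of_seq_tendsto fun ts hts => ?_
    have key : TendstoInMeasure (nuU.prod nuU) (fun k => Y (ts k)) atTop (Y t) := by
      refine tendstoInMeasure_of_tendsto_ae (fun k => (hY _).aestronglyMeasurable) ?_
      have hms : MeasurableSet {p | Tendsto (fun k => Y (ts k) p) atTop (𝓝 (Y t p))} :=
        measurableSet_tendsto_fun (fun k => hY _) (hY t)
      rw [Measure.ae_prod_iff_ae_ae hms]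
      filter_upwards [sphere_null (β t : Measure S)] with r hr
      have hinv : ∀ s, ∀ᵐ u ∂nuU, hS r (Y s (r, u)) = qt ((β s : Measure S).map (hS r)) u := by
        intro s
        have := hpr s r
        have h1 : ∀ᵐ z ∂((β s : Measure S).map (hS r)), hS r (g (r, z)) = z := by
          rw [ae_map_iff (p := fun z => hS r (g (r, z)) = z) (hS_meas r).aemeasurable
            (measurableSet_eq_fun ((hS_meas r).comp (hgr r)) measurable_id)]
          exact ae_of_all _ fun y => by simp [hgh]
        rw [← map_qt ((β s : Measure S).map (hS r))] at h1
        exact ae_of_ae_map (measurable_qt' _).aemeasurable h1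
      have := hpr t r
      have hq := qt_tendsto ((β t : Measure S).map (hS r))
        (fun k => (β (ts k) : Measure S).map (hS r))
        (fun x hx => cdf_conv ((hβ.tendsto t).comp hts) hr x hx)
      filter_upwards [hq, hinv t, ae_all_iff.2 fun k => hinv (ts k)] with u hu h2 h3
      refine tendsto_of_hS (r := r) ?_
      simp_rw [h2, h3]
      exact hu
    exact key ε hε

end skor

lemma skorokhod {S : Type*} [MetricSpace S] [TopologicalSpace.SeparableSpace S]
    [MeasurableSpace S] [BorelSpace S] [CompleteSpace S]
    (β : ℝ → ProbabilityMeasure S) (hβ : Continuous β) :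
    ∃ Y : ℝ → ℝ → S, (∀ t, Measurable (Y t)) ∧
      (∀ t, nuU.map (Y t) = β t) ∧
      ∀ t, TendstoInMeasure nuU Y (𝓝 t) (Y t) := by
  have : Nonempty S := (β 0 : Measure S).nonempty_of_neZero
  obtain ⟨Y, h1, h2, h3⟩ := skorokhod_prod β hβ
  have : NullSingletonClass (nuU.prod nuU) := inferInstance
  obtain ⟨h, q, -, hq, -, -⟩ := exists_iso (nuU.prod nuU)
  refine ⟨fun t => Y t ∘ q, fun t => (h1 t).comp hq.measurable, fun t => ?_, fun t => ?_⟩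
  · rw [← Measure.map_map (h1 t) hq.measurable, hq.map_eq, h2]
  · rw [tendstoInMeasure_iff_dist]
    intro ε hε
    exact tim_comp_left nuU (nuU.prod nuU) (V := fun _ => q) (Eventually.of_forall fun _ => hq)
      (Eventually.of_forall fun s => h1 s) (h1 t) (h3 t) ε hε

open Classical in
lemma exists_nonatomic_map {Ω : Type*} [MeasurableSpace Ω] (P : Measure Ω) [IsProbabilityMeasure P]
    (hna : Nonatomic P) :
    ∃ T : Ω → (ℕ → Bool), Measurable T ∧ ∀ x, P (T ⁻¹' {x}) = 0 := by
  let J : (Ω → (ℕ → Bool)) → ℝ≥0∞ := fun T => (P.prod P) {p | T p.1 = T p.2}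
  have hJ1 : ∀ T, J T ≤ 1 := fun T => prob_le_one
  have hne : ∀ n : ℕ, ∃ T : Ω → (ℕ → Bool), Measurable T ∧
      ∀ T', Measurable T' → J T ≤ J T' + (1 / ((n:ℝ≥0∞) + 1)) := by
    intro n
    let m : ℝ≥0∞ := ⨅ T : {T : Ω → (ℕ → Bool) // Measurable T}, J T
    have hm : m ≠ ∞ := by
      have : m ≤ J (fun _ _ => true) := iInf_le
        (fun T : {T : Ω → (ℕ → Bool) // Measurable T} => J T) ⟨fun _ _ => true, measurable_const⟩
      exact ne_top_of_le_ne_top ENNReal.one_ne_top (this.trans (hJ1 (fun _ _ => true)))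
    have hlt : m < m + 1 / ((n:ℝ≥0∞) + 1) :=
      ENNReal.lt_add_right hm (by simp)
    obtain ⟨T, hT⟩ := iInf_lt_iff.1 hlt
    refine ⟨T, T.2, fun T' hT' => hT.le.trans ?_⟩
    gcongr
    exact iInf_le (fun T : {T : Ω → (ℕ → Bool) // Measurable T} => J T) ⟨T', hT'⟩
  choose T hTm hT using hne
  let U : Ω → (ℕ → Bool) := fun ω k => T k.unpair.1 ω k.unpair.2
  have hU : Measurable U := measurable_pi_lambda _ fun k =>
    (measurable_pi_apply _).comp (hTm _)
  have hUT : ∀ n, J U ≤ J (T n) := by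
    intro n
    apply measure_mono
    intro p hp
    have hp' : U p.1 = U p.2 := hp
    change T n p.1 = T n p.2
    funext k
    have := congrFun hp' (Nat.pair n k)
    simpa [U] using this
  have hmin : ∀ T', Measurable T' → J U ≤ J T' := by
    intro T' hT'
    have h1 : Tendsto (fun n : ℕ => J T' + (1 / ((n:ℝ≥0∞) + 1))) atTop (𝓝 (J T' + 0)) := by
      refine tendsto_const_nhds.add ?_
      have := (tendsto_add_atTop_iff_nat 1).2 ENNReal.tendsto_inv_nat_nhds_zero
      simpa using this
    rw [add_zero] at h1
    exact ge_of_tendsto' h1 fun n => (hUT n).trans (hT n T' hT')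
  refine ⟨U, hU, fun x => ?_⟩
  by_contra hx
  have hA : MeasurableSet (U ⁻¹' {x}) := hU (measurableSet_singleton x)
  obtain ⟨B, hBA, hB, hB0, hBlt⟩ := hna _ hA (pos_iff_ne_zero.2 hx)
  let T' : Ω → (ℕ → Bool) := fun ω k => if k = 0 then decide (ω ∈ B) else U ω (k - 1)
  have hT' : Measurable T' := by
    refine measurable_pi_lambda _ fun k => ?_
    by_cases hk : k = 0
    · simp only [T', hk, if_true]
      refine measurable_to_bool ?_
      have : (fun ω => decide (ω ∈ B)) ⁻¹' {true} = B := by ext; simp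
      rwa [this]
    · simp only [T', hk, if_false]
      exact (measurable_pi_apply (k - 1)).comp hU
  have hd : 0 < P ((U ⁻¹' {x}) \ B) := by
    rw [measure_sdiff hBA hB.nullMeasurableSet (measure_ne_top _ _)]
    exact tsub_pos_of_lt hBlt
  have hsum : J T' + (P.prod P) (B ×ˢ ((U ⁻¹' {x}) \ B)) ≤ J U := by
    rw [← measure_union _ (hB.prod (hA.diff hB))]
    · apply measure_mono
      rintro p (hp | hp)
      · have hp' : T' p.1 = T' p.2 := hp
        change U p.1 = U p.2
        funext k
        simpa [T'] using congrFun hp' (k+1)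
      · have h1 : U p.1 = x := hBA hp.1
        have h2 : U p.2 = x := hp.2.1
        change U p.1 = U p.2
        rw [h1, h2]
    · rw [Set.disjoint_left]
      intro p hp hp2
      have hp' : T' p.1 = T' p.2 := hp
      have := congrFun hp' 0
      simp only [T', if_true, decide_eq_decide] at this
      exact hp2.2.2 (this.1 hp2.1)
  rw [Measure.prod_prod] at hsum
  have hpos : 0 < P B * P ((U ⁻¹' {x}) \ B) := ENNReal.mul_pos hB0.ne' hd.ne'
  have hfin : J T' ≠ ∞ := ne_top_of_le_ne_top ENNReal.one_ne_top (hJ1 _)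
  exact absurd ((ENNReal.lt_add_right hfin hpos.ne').trans_le (hsum.trans (hmin T' hT')))
    (lt_irrefl _)

lemma tim_mono {X S κ : Type*} [MeasurableSpace X] [PseudoMetricSpace S] {l l' : Filter κ}
    {μ : Measure X} {f : κ → X → S} {g : X → S} (h : TendstoInMeasure μ f l g) (hl : l' ≤ l) :
    TendstoInMeasure μ f l' g := fun ε hε => (h ε hε).mono_left hl

lemma tim_pull {X S κ κ' : Type*} [MeasurableSpace X] [PseudoMetricSpace S] {l : Filter κ}
    {l' : Filter κ'} {φ : κ' → κ}
    {μ : Measure X} {f : κ → X → S} {g : X → S} (h : TendstoInMeasure μ f l g)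
    (hl : Tendsto φ l' l) :
    TendstoInMeasure μ (fun k => f (φ k)) l' g := fun ε hε => (h ε hε).comp hl

lemma tim_insert {X S : Type*} [MeasurableSpace X] [PseudoMetricSpace S] {t : ℝ} {s : Set ℝ}
    {μ : Measure X} {f : ℝ → X → S} {l' : Filter ℝ} (h : TendstoInMeasure μ f (𝓝[s] t) (f t))
    (hl : l' ≤ 𝓝[insert t s] t) : TendstoInMeasure μ f l' (f t) := by
  refine tim_mono ?_ hl
  rw [nhdsWithin_insert]
  intro ε hε
  refine Tendsto.sup ?_ (h ε hε)
  rw [tendsto_pure_left]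
  intro s hs
  simp only [edist_self, nonpos_iff_eq_zero, hε.ne', ofPred_false, measure_empty]
  exact mem_of_mem_nhds hs

lemma path_real {S : Type*} [MetricSpace S] [TopologicalSpace.SeparableSpace S]
    [MeasurableSpace S] [BorelSpace S] [CompleteSpace S]
    (β : ℝ → ProbabilityMeasure S) (hβ : Continuous β) {x0 x1 : ℝ → S}
    (hx0 : Measurable x0) (hx1 : Measurable x1) (h0 : nuU.map x0 = β 0) (h1 : nuU.map x1 = β 1) :
    ∃ W : ℝ → ℝ → S, (∀ t, Measurable (W t)) ∧ W 0 = x0 ∧ W 1 = x1 ∧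
      (∀ t, nuU.map (W t) = β t) ∧
      ∀ t ∈ Icc (0:ℝ) 1, TendstoInMeasure nuU W (𝓝[Icc 0 1] t) (W t) := by
  obtain ⟨Y, hYm, hYl, hYt⟩ := skorokhod β hβ
  obtain ⟨V, hV1, hV2, hV3, hV4⟩ := half_lemma (hYm 0) hx0 (by rw [hYl, h0])
  obtain ⟨U, hU1, hU2, hU3, hU4⟩ := half_lemma (hYm 1) hx1 (by rw [hYl, h1])
  let s0 : ℝ → ℝ := fun t => max 0 (t⁻¹ - 2)
  let s1 : ℝ → ℝ := fun t => max 0 ((1 - t)⁻¹ - 2)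
  have hs0 : ∀ t, t ≠ 0 → ContinuousAt s0 t := fun t ht =>
    continuousAt_const.max ((continuousAt_inv₀ ht).sub continuousAt_const)
  have hs1 : ∀ t, t ≠ 1 → ContinuousAt s1 t := fun t ht =>
    continuousAt_const.max (((continuousAt_const.sub continuousAt_id).inv₀
      (sub_ne_zero.2 (Ne.symm ht))).sub continuousAt_const)
  let W : ℝ → ℝ → S := fun t => if t = 0 then x0 else if t = 1 then x1 else
    (Y t ∘ V (s0 t)) ∘ U (s1 t)
  have hW0 : W 0 = x0 := by simp [W]
  have hW1 : W 1 = x1 := by simp [W]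
  have hWt : ∀ t, t ≠ 0 → t ≠ 1 → W t = (Y t ∘ V (s0 t)) ∘ U (s1 t) := by
    intro t h h'; simp [W, h, h']
  have hYV : ∀ t s, Measurable (Y t ∘ V s) := fun t s => (hYm t).comp (hV1 s).measurable
  refine ⟨W, ?_, hW0, hW1, ?_, ?_⟩
  · intro t
    by_cases ht0 : t = 0
    · rw [ht0, hW0]; exact hx0
    by_cases ht1 : t = 1
    · rw [ht1, hW1]; exact hx1
    rw [hWt t ht0 ht1]
    exact (hYV _ _).comp (hU1 _).measurable
  · intro t
    by_cases ht0 : t = 0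
    · rw [ht0, hW0, h0]
    by_cases ht1 : t = 1
    · rw [ht1, hW1, h1]
    rw [hWt t ht0 ht1, ← Measure.map_map (hYV _ _) (hU1 _).measurable, (hU1 _).map_eq,
      ← Measure.map_map (hYm _) (hV1 _).measurable, (hV1 _).map_eq, hYl]
  · intro t ht
    by_cases ht0 : t = 0
    · subst ht0
      refine tim_insert (s := Ioi 0) ?_ ?_
      · have hev : ∀ᶠ s : ℝ in 𝓝[>] 0, s < 1/2 :=
          nhdsWithin_le_nhds (eventually_lt_nhds (by norm_num))
        have hs0t : Tendsto s0 (𝓝[>] 0) atTop :=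
          tendsto_atTop_mono (fun s => le_max_right _ _)
            (tendsto_atTop_add_const_right _ (-2) tendsto_inv_nhdsGT_zero)
        rw [hW0]
        refine TendstoInMeasure.congr' (f := fun s => Y s ∘ V (s0 s)) (g := x0) ?_
          EventuallyEq.rfl ?_
        · filter_upwards [hev, self_mem_nhdsWithin] with s hs hs'
          have hs' : 0 < s := hs'
          have e1 : s1 s = 0 := by
            apply max_eq_left
            have : (1 - s)⁻¹ ≤ (1/2 : ℝ)⁻¹ := inv_anti₀ (by norm_num) (by linarith)
            norm_num at this ⊢; linarith
          rw [hWt s hs'.ne' (by linarith), e1]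
          filter_upwards [hU2] with u hu
          simp only [Function.comp, hu]
        · refine tim_triangle nuU (g := fun s => Y 0 ∘ V (s0 s)) ?_ (tim_pull (f := fun s => Y 0 ∘ V s) (φ := s0) hV4 hs0t)
          intro ε hε
          exact tim_comp_left nuU nuU (V := fun s => V (s0 s)) (A := Y) (A0 := Y 0)
            (Eventually.of_forall fun _ => hV1 _) (Eventually.of_forall hYm) (hYm 0)
            (tim_mono (hYt 0) nhdsWithin_le_nhds) ε hε
      · refine nhdsWithin_mono _ fun s hs => ?_
        rw [Ioi_insert]; exact hs.1
    by_cases ht1 : t = 1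
    · subst ht1
      refine tim_insert (s := Iio 1) ?_ ?_
      · have hev : ∀ᶠ s : ℝ in 𝓝[<] 1, 1/2 < s :=
          nhdsWithin_le_nhds (eventually_gt_nhds (by norm_num))
        have hsub : Tendsto (fun s : ℝ => 1 - s) (𝓝[<] 1) (𝓝[>] 0) := by
          refine tendsto_nhdsWithin_iff.2 ⟨?_, ?_⟩
          · have : Tendsto (fun s : ℝ => 1 - s) (𝓝 1) (𝓝 (1 - 1)) :=
              (continuous_const.sub continuous_id).tendsto 1
            rw [sub_self] at this
            exact this.mono_left nhdsWithin_le_nhds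
          · filter_upwards [self_mem_nhdsWithin] with s hs
            exact sub_pos.2 (show s < 1 from hs)
        have hs1t : Tendsto s1 (𝓝[<] 1) atTop :=
          tendsto_atTop_mono (fun s => le_max_right _ _)
            (tendsto_atTop_add_const_right _ (-2) (tendsto_inv_nhdsGT_zero.comp hsub))
        rw [hW1]
        refine TendstoInMeasure.congr' (f := fun s => Y s ∘ U (s1 s)) (g := x1) ?_
          EventuallyEq.rfl ?_
        · filter_upwards [hev, self_mem_nhdsWithin] with s hs hs'
          have hs' : s < 1 := hs'
          have e1 : s0 s = 0 := by
            apply max_eq_left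
            have : s⁻¹ ≤ (1/2 : ℝ)⁻¹ := inv_anti₀ (by norm_num) (by linarith)
            norm_num at this ⊢; linarith
          rw [hWt s (by linarith) hs'.ne, e1]
          filter_upwards [(hU1 (s1 s)).quasiMeasurePreserving.ae hV2] with u hu
          simp only [Function.comp, hu]
        · refine tim_triangle nuU (g := fun s => Y 1 ∘ U (s1 s)) ?_ 
            (tim_pull (f := fun s => Y 1 ∘ U s) (φ := s1) hU4 hs1t)
          intro ε hε
          exact tim_comp_left nuU nuU (V := fun s => U (s1 s)) (A := Y) (A0 := Y 1)
            (Eventually.of_forall fun _ => hU1 _) (Eventually.of_forall hYm) (hYm 1)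
            (tim_mono (hYt 1) nhdsWithin_le_nhds) ε hε
      · refine nhdsWithin_mono _ fun s hs => ?_
        rw [Iio_insert]; exact hs.2
    refine tim_mono ?_ nhdsWithin_le_nhds
    rw [hWt t ht0 ht1]
    refine TendstoInMeasure.congr' (f := fun s => (Y s ∘ V (s0 s)) ∘ U (s1 s)) ?_
          EventuallyEq.rfl ?_
    · filter_upwards [isOpen_ne.mem_nhds ht0, isOpen_ne.mem_nhds ht1] with s h h'
      rw [hWt s h h']
    · exact tim_comp nuU nuU (V := fun s => U (s1 s)) (A := fun s => Y s ∘ V (s0 s))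
        (Eventually.of_forall fun _ => hU1 _) (hU1 _) (tim_pull (hU3 _) (hs1 t ht1))
        (Eventually.of_forall fun _ => hYV _ _) (hYV _ _)
        (tim_comp nuU nuU (V := fun s => V (s0 s)) (A := Y) (Eventually.of_forall fun _ => hV1 _)
          (hV1 _) (tim_pull (hV3 _) (hs0 t ht0)) (Eventually.of_forall hYm) (hYm _) (hYt t))

lemma exists_beta {S : Type*} [MeasurableSpace S] [MetricSpace S] [BorelSpace S]
    [TopologicalSpace.SeparableSpace S] (α : ℝ → Measure S)
    (hprob : ∀ t ∈ Set.Icc (0 : ℝ) 1, IsProbabilityMeasure (α t))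
    (hcont : LPContinuousOn α (Set.Icc 0 1)) :
    ∃ β : ℝ → ProbabilityMeasure S, Continuous β ∧ ∀ t ∈ Icc (0:ℝ) 1, (β t : Measure S) = α t := by
  let p : ℝ → ℝ := fun t => (projIcc (0:ℝ) 1 zero_le_one t : ℝ)
  have hpm : ∀ t, p t ∈ Icc (0:ℝ) 1 := fun t => (projIcc (0:ℝ) 1 zero_le_one t).2
  have hpc : Continuous p := continuous_subtype_val.comp continuous_projIcc
  let β : ℝ → ProbabilityMeasure S := fun t => ⟨α (p t), hprob _ (hpm t)⟩
  refine ⟨β, ?_, ?_⟩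
  · have h1 : Continuous (fun t => LevyProkhorov.ofMeasure (β t)) := by
      rw [Metric.continuous_iff]
      intro t ε hε
      obtain ⟨δ, hδ, h⟩ := hcont (p t) (hpm t) ε hε
      obtain ⟨δ', hδ', h'⟩ := Metric.continuous_iff.1 hpc t δ hδ
      refine ⟨δ', hδ', fun s hs => ?_⟩
      rw [LevyProkhorov.dist_probabilityMeasure_def]
      exact h (p s) (hpm s) (h' s hs)
    exact LevyProkhorov.continuous_toMeasure_probabilityMeasure.comp h1
  · intro t ht
    have : p t = t := by simp only [p, projIcc_of_mem zero_le_one ht]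
    change α (p t) = α t
    rw [this]

lemma kyFan_of_tim {Ω S : Type*} [MeasurableSpace Ω] [PseudoMetricSpace S]
    (P : Measure Ω) [IsFiniteMeasure P] (γ : ℝ → Ω → S) (A : Set ℝ)
    (h : ∀ t ∈ A, TendstoInMeasure P γ (𝓝[A] t) (γ t)) : KyFanContinuousOn P γ A := by
  intro t ht ε hε
  have h1 := tendstoInMeasure_iff_dist.1 (h t ht) (ε/2) (half_pos hε)
  have h2 := (ENNReal.tendsto_nhds_zero.1 h1) (ENNReal.ofReal (ε/2))
    (ENNReal.ofReal_pos.2 (half_pos hε))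
  rw [eventually_nhdsWithin_iff, Metric.eventually_nhds_iff] at h2
  obtain ⟨δ, hδ, h3⟩ := h2
  refine ⟨δ, hδ, fun s hs hst => ?_⟩
  have h4 := h3 (y := s) hst hs
  have : kyFanDist P (γ s) (γ t) ≤ ε/2 := by
    refine csInf_le ⟨0, fun x hx => hx.1.le⟩ ⟨half_pos hε, ?_⟩
    exact ENNReal.toReal_le_of_le_ofReal (half_pos hε).le h4
  linarith

/-- Main theorem: every continuous path `α : [0,1] → P(S)` lifts to a continuous path
`α̂ : [0,1] → L⁰(Ω,S)` with prescribed endpoints `X_μ`, `X_ν` of laws `α 0`, `α 1`. -/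
theorem stmt15 {Ω S : Type*} [MeasurableSpace Ω] [MeasurableSpace S] [MetricSpace S]
    [BorelSpace S] [CompleteSpace S] [TopologicalSpace.SeparableSpace S]
    (P : Measure Ω) [IsProbabilityMeasure P] (hna : Nonatomic P)
    (α : ℝ → Measure S) (hprob : ∀ t ∈ Set.Icc (0 : ℝ) 1, IsProbabilityMeasure (α t))
    (hcont : LPContinuousOn α (Set.Icc 0 1))
    (Xμ Xν : Ω → S) (hXμ : Measurable Xμ) (hXν : Measurable Xν)
    (hlaw0 : P.map Xμ = α 0) (hlaw1 : P.map Xν = α 1) :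
    ∃ αhat : ℝ → Ω → S,
      (∀ t ∈ Set.Icc (0 : ℝ) 1, Measurable (αhat t)) ∧
      KyFanContinuousOn P αhat (Set.Icc 0 1) ∧
      αhat 0 = Xμ ∧ αhat 1 = Xν ∧
      ∀ t ∈ Set.Icc (0 : ℝ) 1, P.map (αhat t) = α t := by
  obtain ⟨β, hβc, hβ⟩ := exists_beta α hprob hcont
  obtain ⟨T, hT, hT0⟩ := exists_nonatomic_map P hna
  have hZ : Measurable (fun ω => (Xμ ω, Xν ω, T ω)) := hXμ.prodMk (hXν.prodMk hT)
  set Z : Ω → S × S × (ℕ → Bool) := fun ω => (Xμ ω, Xν ω, T ω) with hZdef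
  have hZp : IsProbabilityMeasure (P.map Z) := Measure.isProbabilityMeasure_map hZ.aemeasurable
  have hZn : NullSingletonClass (P.map Z) := ⟨fun z => by
    rw [Measure.map_apply hZ (measurableSet_singleton z)]
    refine measure_mono_null ?_ (hT0 z.2.2)
    intro ω hω
    have : Z ω = z := hω
    change T ω = z.2.2
    rw [← this]⟩
  obtain ⟨h, q, hh, hq, hqh, -⟩ := exists_iso (P.map Z)
  have hZmp : MeasurePreserving Z P (P.map Z) := ⟨hZ, rfl⟩
  have hV := hh.comp hZmp
  have hqZ : ∀ᵐ ω ∂P, q (h (Z ω)) = Z ω := hZmp.quasiMeasurePreserving.ae hqh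
  have hx0 : Measurable (fun u => (q u).1) := measurable_fst.comp hq.measurable
  have hx1 : Measurable (fun u => (q u).2.1) :=
    (measurable_fst.comp measurable_snd).comp hq.measurable
  have h0 : nuU.map (fun u => (q u).1) = β 0 := by
    rw [hβ 0 (by simp), ← hlaw0, show (fun u => (q u).1) = Prod.fst ∘ q from rfl,
      ← Measure.map_map measurable_fst hq.measurable, hq.map_eq,
      Measure.map_map measurable_fst hZ]
    rfl
  have h1 : nuU.map (fun u => (q u).2.1) = β 1 := by
    rw [hβ 1 (by simp), ← hlaw1,
      show (fun u => (q u).2.1) = (Prod.fst ∘ Prod.snd) ∘ q from rfl,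
      ← Measure.map_map (measurable_fst.comp measurable_snd) hq.measurable, hq.map_eq,
      Measure.map_map (measurable_fst.comp measurable_snd) hZ]
    rfl
  obtain ⟨W, hWm, hW0, hW1, hWl, hWt⟩ := path_real β hβc hx0 hx1 h0 h1
  let γ : ℝ → Ω → S := fun t => if t = 0 then Xμ else if t = 1 then Xν else W t ∘ (h ∘ Z)
  have hγ0 : γ 0 = Xμ := by simp [γ]
  have hγ1 : γ 1 = Xν := by simp [γ]
  have hγt : ∀ t, t ≠ 0 → t ≠ 1 → γ t = W t ∘ (h ∘ Z) := by
    intro t h h'; simp [γ, h, h']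
  have hγae : ∀ t, W t ∘ (h ∘ Z) =ᵐ[P] γ t := by
    intro t
    by_cases ht0 : t = 0
    · rw [ht0, hγ0, hW0]
      filter_upwards [hqZ] with ω hω
      simp only [Function.comp, hω]
      rfl
    by_cases ht1 : t = 1
    · rw [ht1, hγ1, hW1]
      filter_upwards [hqZ] with ω hω
      simp only [Function.comp, hω]
      rfl
    rw [hγt t ht0 ht1]
  refine ⟨γ, ?_, ?_, hγ0, hγ1, ?_⟩
  · intro t _
    by_cases ht0 : t = 0
    · rw [ht0, hγ0]; exact hXμ
    by_cases ht1 : t = 1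
    · rw [ht1, hγ1]; exact hXν
    rw [hγt t ht0 ht1]
    exact (hWm t).comp hV.measurable
  · refine kyFan_of_tim P γ _ fun t ht => ?_
    refine TendstoInMeasure.congr' (f := fun s => W s ∘ (h ∘ Z)) (g := W t ∘ (h ∘ Z))
      (Eventually.of_forall fun s => hγae s) (hγae t) ?_
    rw [tendstoInMeasure_iff_dist]
    intro ε hε
    exact tim_comp_left P nuU (V := fun _ => h ∘ Z) (A := W) (A0 := W t)
      (Eventually.of_forall fun _ => hV) (Eventually.of_forall hWm) (hWm t) (hWt t ht) ε hε
  · intro t ht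
    rw [← Measure.map_congr (hγae t), ← Measure.map_map (hWm t) hV.measurable, hV.map_eq, hWl,
      hβ t ht]
end
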